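/- Suppose f satisfies Assumption 1. Then there exists a constant C(f,k) > 0 depending only on f and k such that for all n ≥ 4(k−1), sup_{x∈ℝ} |P(S̄_{n,k}(f) ≤ x) − Φ(x)| ≤ C(f,k) · n^{−1/(2+4k)}, where Φ is the cumulative distribution function of the standard normal distribution. -/

import Mathlib

open MeasureTheory Finset ProbabilityTheory

/-- The joint cumulant, via the moment–cumulant formula. -/
noncomputable def jointCumulant {Ω : Type*} [MeasurableSpace Ω] (P : Measure Ω)
    {j : ℕ} (Z : Fin j → Ω → ℝ) : ℝ :=
  ∑ σ : Finpartition (Finset.univ : Finset (Fin j)),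
    (-1 : ℝ) ^ (σ.parts.card - 1) * ((σ.parts.card - 1).factorial : ℝ) *
      ∏ b ∈ σ.parts, ∫ ω, ∏ i ∈ b, Z i ω ∂P

/-- The `j`-th cumulant `κ_j(W)` of a random variable `W`. -/
noncomputable def cum {Ω : Type*} [MeasurableSpace Ω] (P : Measure Ω)
    (j : ℕ) (W : Ω → ℝ) : ℝ :=
  jointCumulant P (fun _ : Fin j => W)

/-- The generalized U-statistic
`S_{n,k}(f) = Σ_{β injective} f(X_{β(1)},…,X_{β(k)}, Y_{β(1),β(2)},…,Y_{β(k-1),β(k)})`. -/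
noncomputable def genU {S M Ω : Type*} {k n : ℕ}
    (f : (Fin k → S) → ({q : Fin k × Fin k // q.1 < q.2} → M) → ℝ)
    (X : Fin n → Ω → S) (Y : Fin n → Fin n → Ω → M) (ω : Ω) : ℝ :=
  ∑ β ∈ (Finset.univ : Finset (Fin k → Fin n)).filter Function.Injective,
    f (fun i => X (β i) ω) (fun q => Y (β q.1.1) (β q.1.2) ω)

/-- The projection `f_{(ℓ)}(x) = ∫ f(x_1,…,x_{ℓ−1},x,x_{ℓ+1},…,x_k,y) dμ^{⊗(k−1)} dQ^{⊗k(k−1)/2}`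
(the unused `ℓ`-th coordinate is also integrated out, which is harmless since `μ` is a
probability measure). -/
noncomputable def fProj {S M : Type*} [MeasurableSpace S] [MeasurableSpace M] {k : ℕ}
    (f : (Fin k → S) → ({q : Fin k × Fin k // q.1 < q.2} → M) → ℝ)
    (μ : Measure S) (Q : Measure M) (ℓ : Fin k) (x : S) : ℝ :=
  ∫ z : (Fin k → S) × ({q : Fin k × Fin k // q.1 < q.2} → M),
    f (Function.update z.1 ℓ x) z.2
    ∂((Measure.pi fun _ => μ).prod (Measure.pi fun _ => Q))

/-- The normalized generalized U-statistic
`S̄_{n,k}(f) = (S_{n,k}(f) − E[S_{n,k}(f)])/√Var(S_{n,k}(f))`. -/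
noncomputable def genUbar {S M Ω : Type*} [MeasurableSpace Ω] {k n : ℕ}
    (P : Measure Ω)
    (f : (Fin k → S) → ({q : Fin k × Fin k // q.1 < q.2} → M) → ℝ)
    (X : Fin n → Ω → S) (Y : Fin n → Fin n → Ω → M) (ω : Ω) : ℝ :=
  (genU f X Y ω - ∫ ω', genU f X Y ω' ∂P) / Real.sqrt (variance (genU f X Y) P)

/-- The cumulative distribution function `Φ` of the standard normal distribution. -/
noncomputable def gaussCdf (x : ℝ) : ℝ :=
  (Real.sqrt (2 * Real.pi))⁻¹ * ∫ t in Set.Iic x, Real.exp (-(t ^ 2) / 2)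

/-- `h` has a second-order Taylor expansion at every point, with remainder at most `K|b|³`. -/
def CubicTaylorBound (K : ℝ) (h : ℝ → ℝ) : Prop :=
  ∃ h₁ h₂ : ℝ → ℝ, ∀ a b, |h (a + b) - h a - h₁ a * b - h₂ a * b ^ 2| ≤ K * |b| ^ 3

theorem bounded_iteratedDeriv_of_const_outside {φ : ℝ → ℝ} (hφ : ContDiff ℝ 3 φ)
    (h0 : ∀ t < 0, ∀ m, 1 ≤ m → iteratedDeriv m φ t = 0)
    (h1 : ∀ t > 1, ∀ m, 1 ≤ m → iteratedDeriv m φ t = 0) (m : ℕ) (hm : 1 ≤ m) (hm3 : m ≤ 3) :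
    ∃ K ≥ 0, ∀ t, |iteratedDeriv m φ t| ≤ K := by
  have hc : Continuous (iteratedDeriv m φ) :=
    hφ.continuous_iteratedDeriv m (by exact_mod_cast hm3)
  obtain ⟨K, hK⟩ := (isCompact_Icc (a := (0 : ℝ)) (b := 1)).exists_bound_of_continuousOn
    hc.continuousOn
  refine ⟨max K 0, le_max_right _ _, fun t => ?_⟩
  rcases lt_or_ge t 0 with ht | ht
  · simp [h0 t ht m hm]
  rcases lt_or_ge 1 t with ht' | ht'
  · simp [h1 t ht' m hm]
  exact (hK t ⟨ht, ht'⟩).trans (le_max_left _ _)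

theorem iteratedDeriv_eq_zero_of_eventually_const {φ : ℝ → ℝ} {c t : ℝ}
    (h : φ =ᶠ[nhds t] fun _ => c) (m : ℕ) (hm : 1 ≤ m) : iteratedDeriv m φ t = 0 := by
  rw [h.iteratedDeriv_eq]
  simp [iteratedDeriv_const]; omega

theorem exists_smooth_step : ∃ φ : ℝ → ℝ, ∃ K > 0, Continuous φ ∧ (∀ t, 0 ≤ φ t) ∧
    (∀ t, φ t ≤ 1) ∧ (∀ t ≤ 0, φ t = 1) ∧ (∀ t, 1 ≤ t → φ t = 0) ∧
    (∀ a b, |φ a - φ b| ≤ K * |a - b|) ∧ CubicTaylorBound K φ := by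
  let φ : ℝ → ℝ := fun t => Real.smoothTransition (1 - t)
  have hφ : ContDiff ℝ 3 φ := Real.smoothTransition.contDiff.comp (by fun_prop)
  have hl : ∀ t ≤ 0, φ t = 1 := fun t ht =>
    Real.smoothTransition.one_of_one_le (by linarith)
  have hr : ∀ t, 1 ≤ t → φ t = 0 := fun t ht =>
    Real.smoothTransition.zero_of_nonpos (by linarith)
  have h0 : ∀ t < 0, ∀ m, 1 ≤ m → iteratedDeriv m φ t = 0 := fun t ht m hm => by
    refine iteratedDeriv_eq_zero_of_eventually_const (c := 1) ?_ m hm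
    filter_upwards [Iio_mem_nhds ht] with s hs using hl s (le_of_lt hs)
  have h1 : ∀ t > 1, ∀ m, 1 ≤ m → iteratedDeriv m φ t = 0 := fun t ht m hm => by
    refine iteratedDeriv_eq_zero_of_eventually_const (c := 0) ?_ m hm
    filter_upwards [Ioi_mem_nhds ht] with s hs using hr s (le_of_lt hs)
  obtain ⟨K₁, hK₁0, hK₁⟩ := bounded_iteratedDeriv_of_const_outside hφ h0 h1 1 le_rfl (by norm_num)
  obtain ⟨K₃, hK₃0, hK₃⟩ := bounded_iteratedDeriv_of_const_outside hφ h0 h1 3 (by norm_num) le_rfl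
  refine ⟨φ, K₁ + K₃ + 1, by positivity, hφ.continuous, fun t => Real.smoothTransition.nonneg _,
    fun t => Real.smoothTransition.le_one _, hl, hr, fun a b => ?_,
    fun a => deriv φ a, fun a => iteratedDeriv 2 φ a / 2, fun a b => ?_⟩
  · have := Convex.norm_image_sub_le_of_norm_deriv_le (f := φ) (s := Set.univ) (C := K₁)
      (x := b) (y := a) (fun x _ => (hφ.differentiable (by norm_num)) x)
      (fun x _ => by simpa [iteratedDeriv_one] using hK₁ x) convex_univ trivial trivial
    simp only [Real.norm_eq_abs] at this
    exact this.trans (by gcongr; linarith)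
  · rcases eq_or_ne b 0 with rfl | hb
    · simp
    have hne : a ≠ a + b := by simpa using hb
    obtain ⟨x', -, hx'⟩ := taylor_mean_remainder_lagrange_iteratedDeriv (n := 2) hne
      (f := φ) (by exact_mod_cast hφ.contDiffOn)
    have hu : UniqueDiffOn ℝ (Set.uIcc a (a + b)) := uniqueDiffOn_uIcc hne
    rw [taylor_within_apply] at hx'
    have hd : ∀ m : ℕ, m ≤ 3 → iteratedDerivWithin m φ (Set.uIcc a (a + b)) a =
        iteratedDeriv m φ a := fun m hm =>
      iteratedDerivWithin_eq_iteratedDeriv hu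
        (hφ.contDiffAt.of_le (by exact_mod_cast hm)) Set.left_mem_uIcc
    simp only [Finset.sum_range_succ, Finset.sum_range_zero, hd 0 (by norm_num),
      hd 1 (by norm_num), hd 2 (by norm_num), iteratedDeriv_zero, iteratedDeriv_one] at hx'
    have key : φ (a + b) - φ a - deriv φ a * b - iteratedDeriv 2 φ a / 2 * b ^ 2 =
        iteratedDeriv 3 φ x' * b ^ 3 / 6 := by
      simp [Nat.factorial] at hx'
      linear_combination hx'
    rw [key, abs_div, abs_mul, abs_pow]
    have := hK₃ x'
    have hb3 : 0 ≤ |b| ^ 3 := by positivity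
    rw [abs_of_pos (by norm_num : (0:ℝ) < 6), div_le_iff₀ (by norm_num)]
    nlinarith [mul_le_mul_of_nonneg_right this hb3, mul_nonneg hK₁0 hb3, mul_nonneg hK₃0 hb3]

theorem CubicTaylorBound.comp_affine {K : ℝ} {φ : ℝ → ℝ} (h : CubicTaylorBound K φ) (c d : ℝ) :
    CubicTaylorBound (K * |c| ^ 3) (fun t => φ (c * t + d)) := by
  obtain ⟨h₁, h₂, H⟩ := h
  refine ⟨fun a => h₁ (c * a + d) * c, fun a => h₂ (c * a + d) * c ^ 2, fun a b => ?_⟩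
  have := H (c * a + d) (c * b)
  rw [abs_mul, mul_pow] at this
  convert this using 1
  · congr 1
    beta_reduce
    rw [show c * (a + b) + d = c * a + d + c * b by ring]; ring
  · ring

theorem Continuous.integrable_comp_of_bounded {h : ℝ → ℝ} (hc : Continuous h)
    (hb : ∀ t, |h t| ≤ 1) {α : Type*} [MeasurableSpace α] (ρ : Measure α) [IsProbabilityMeasure ρ]
    (F : α → ℝ) (hF : AEMeasurable F ρ) : Integrable (fun s => h (F s)) ρ :=
  Integrable.of_bound (hc.measurable.comp_aemeasurable hF).aestronglyMeasurable 1
    (ae_of_all _ fun s => by simpa using hb _)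

theorem abs_integral_sub_taylor_le {S : Type*} [MeasurableSpace S] (μ : Measure S)
    [IsProbabilityMeasure μ] {g : S → ℝ} (hg3 : MemLp g 3 μ) (h0 : ∫ s, g s ∂μ = 0)
    {h : ℝ → ℝ} (hc : Continuous h) (hb : ∀ t, |h t| ≤ 1) {K a p q : ℝ}
    (hT : ∀ b, |h (a + b) - h a - p * b - q * b ^ 2| ≤ K * |b| ^ 3) :
    |∫ s, h (a + g s) ∂μ - h a - q * ∫ s, g s ^ 2 ∂μ| ≤ K * ∫ s, |g s| ^ 3 ∂μ := by
  have i1 : Integrable g μ := hg3.integrable (by norm_num)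
  have i2 : Integrable (fun s => g s ^ 2) μ := (hg3.mono_exponent (p := 2) (by norm_num)).integrable_sq
  have i3 : Integrable (fun s => |g s| ^ 3) μ := by
    simpa using hg3.integrable_norm_pow (by norm_num)
  have ih : Integrable (fun s => h (a + g s)) μ := by
    refine Integrable.of_bound (hc.comp_aestronglyMeasurable
      (aestronglyMeasurable_const.add hg3.1)) 1 (ae_of_all _ fun s => by simpa using hb _)
  have ih1 : Integrable (fun s => h (a + g s) - h a) μ := ih.sub (integrable_const _)
  have ih2 : Integrable (fun s => h (a + g s) - h a - p * g s) μ := ih1.sub (i1.const_mul p)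
  have e : ∫ s, h (a + g s) ∂μ - h a - q * ∫ s, g s ^ 2 ∂μ =
      ∫ s, (h (a + g s) - h a - p * g s - q * g s ^ 2) ∂μ := by
    rw [integral_sub ih2 (i2.const_mul q), integral_sub ih1 (i1.const_mul p),
      integral_sub ih (by fun_prop), integral_const_mul, integral_const_mul, h0]
    simp
  rw [e, ← integral_const_mul, ← Real.norm_eq_abs]
  exact norm_integral_le_of_norm_le (i3.const_mul K) (ae_of_all _ fun s => hT (g s))

open scoped NNReal in
theorem abs_integral_sum_sub_gaussian_le {S : Type*} [MeasurableSpace S] (μ : Measure S)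
    [IsProbabilityMeasure μ] {g : S → ℝ} (hgm : Measurable g) (hg3 : MemLp g 3 μ)
    (h0 : ∫ s, g s ∂μ = 0) {v : ℝ≥0} (hv : ∫ s, g s ^ 2 ∂μ = v)
    {h : ℝ → ℝ} (hc : Continuous h) (hb : ∀ t, |h t| ≤ 1) {K : ℝ}
    (hT : CubicTaylorBound K h) (n : ℕ) (a : ℝ) :
    |∫ x : Fin n → S, h (a + ∑ i, g (x i)) ∂(Measure.pi fun _ => μ)
      - ∫ t, h (a + t) ∂(gaussianReal 0 (n * v))|
      ≤ n * (K * ∫ s, |g s| ^ 3 ∂μ + K * ∫ t, |t| ^ 3 ∂(gaussianReal 0 v)) := by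
  induction n generalizing a with
  | zero => simp
  | succ n ih =>
    set c := K * ∫ s, |g s| ^ 3 ∂μ + K * ∫ t, |t| ^ 3 ∂(gaussianReal 0 v) with hcdef
    have e1 : ∫ x : Fin (n + 1) → S, h (a + ∑ i, g (x i)) ∂(Measure.pi fun _ => μ) =
        ∫ s, ∫ x : Fin n → S, h (a + g s + ∑ i, g (x i)) ∂(Measure.pi fun _ => μ) ∂μ := by
      have mp := measurePreserving_piFinSuccAbove (fun _ : Fin (n + 1) => μ) 0
      rw [← mp.symm.integral_comp']
      rw [integral_prod]
      · simp [Fin.sum_univ_succ, add_assoc]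
      · exact hc.integrable_comp_of_bounded hb _ (fun z => a + ∑ i, g ((MeasurableEquiv.piFinSuccAbove (fun _ => S) 0).symm z i))
          (by
            have := (MeasurableEquiv.piFinSuccAbove (fun _ : Fin (n+1) => S) 0).symm.measurable
            fun_prop)
    have e2 : ∫ t, h (a + t) ∂(gaussianReal 0 ((n + 1 : ℕ) * v)) =
        ∫ u, ∫ t, h (a + (u + t)) ∂(gaussianReal 0 (n * v)) ∂(gaussianReal 0 v) := by
      have : gaussianReal 0 ((n + 1 : ℕ) * v) =
          (gaussianReal 0 v).conv (gaussianReal 0 (n * v)) := by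
        rw [gaussianReal_conv_gaussianReal]; congr 1
        · simp
        · push_cast; ring
      rw [this, integral_conv]
      exact hc.integrable_comp_of_bounded hb _ (fun t => a + t) (by fun_prop)
    have e3 : ∫ s, ∫ t, h (a + g s + t) ∂(gaussianReal 0 (n * v)) ∂μ =
        ∫ t, ∫ s, h (a + t + g s) ∂μ ∂(gaussianReal 0 (n * v)) := by
      rw [integral_integral_swap]
      · simp only [add_right_comm]
      · exact hc.integrable_comp_of_bounded hb (μ.prod (gaussianReal 0 (n * v))) (fun z => a + g z.1 + z.2) (by fun_prop)
    have e4 : ∫ u, ∫ t, h (a + (u + t)) ∂(gaussianReal 0 (n * v)) ∂(gaussianReal 0 v) =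
        ∫ t, ∫ u, h (a + t + u) ∂(gaussianReal 0 v) ∂(gaussianReal 0 (n * v)) := by
      rw [integral_integral_swap]
      · refine integral_congr_ae (ae_of_all _ fun t => integral_congr_ae (ae_of_all _ fun u => ?_))
        beta_reduce; congr 1; ring
      · exact hc.integrable_comp_of_bounded hb _ (fun z : ℝ × ℝ => a + (z.1 + z.2)) (by fun_prop)
    have b1 : |∫ s, ∫ x : Fin n → S, h (a + g s + ∑ i, g (x i)) ∂(Measure.pi fun _ => μ) ∂μ -
        ∫ s, ∫ t, h (a + g s + t) ∂(gaussianReal 0 (n * v)) ∂μ| ≤ n * c := by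
      rw [← integral_sub]
      · rw [← Real.norm_eq_abs]
        refine (norm_integral_le_of_norm_le_const (C := n * c)
          (ae_of_all _ fun s => ih (a + g s))).trans (by simp)
      · exact (hc.integrable_comp_of_bounded hb (μ.prod (Measure.pi fun _ : Fin n => μ))
          (fun z => a + g z.1 + ∑ i, g (z.2 i)) (by fun_prop)).integral_prod_left
      · exact (hc.integrable_comp_of_bounded hb (μ.prod (gaussianReal 0 (n * v)))
          (fun z => a + g z.1 + z.2) (by fun_prop)).integral_prod_left
    have b2 : |∫ t, ∫ s, h (a + t + g s) ∂μ ∂(gaussianReal 0 (n * v)) -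
        ∫ t, ∫ u, h (a + t + u) ∂(gaussianReal 0 v) ∂(gaussianReal 0 (n * v))| ≤ c := by
      rw [← integral_sub]
      · rw [← Real.norm_eq_abs]
        refine (norm_integral_le_of_norm_le_const (C := c)
          (ae_of_all _ fun t => ?_)).trans (by simp)
        obtain ⟨h₁, h₂, H⟩ := hT
        have t1 := abs_integral_sub_taylor_le μ hg3 h0 hc hb (H (a + t))
        have t2 := abs_integral_sub_taylor_le (gaussianReal 0 v) (g := fun u => u)
          (memLp_id_gaussianReal 3) (by simp) hc hb (H (a + t))
        have : ∫ u, u ^ 2 ∂(gaussianReal 0 v) = v := by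
          have := variance_fun_id_gaussianReal (μ := 0) (v := v)
          rw [variance_eq_integral (by fun_prop)] at this
          simpa using this
        rw [this] at t2
        rw [hv] at t1
        rw [Real.norm_eq_abs, abs_le]
        rw [abs_le] at t1 t2
        constructor <;> linarith [t1.1, t1.2, t2.1, t2.2]
      · exact (hc.integrable_comp_of_bounded hb ((gaussianReal 0 (n * v)).prod μ)
          (fun z => a + z.1 + g z.2) (by fun_prop)).integral_prod_left
      · exact (hc.integrable_comp_of_bounded hb ((gaussianReal 0 (n * v)).prod (gaussianReal 0 v))
          (fun z => a + z.1 + z.2) (by fun_prop)).integral_prod_left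
    rw [e1, e2]
    rw [e3] at b1
    rw [e4]
    rw [abs_le] at b1 b2 ⊢
    push_cast
    constructor <;> linarith [b1.1, b1.2, b2.1, b2.2]

theorem gaussCdf_eq (x : ℝ) : gaussCdf x = (gaussianReal 0 1).real (Set.Iic x) := by
  rw [measureReal_def, gaussianReal_apply_eq_integral _ (by norm_num),
    ENNReal.toReal_ofReal (integral_nonneg fun t => gaussianPDFReal_nonneg _ _ _)]
  simp [gaussCdf, gaussianPDFReal, integral_const_mul]

theorem gaussCdf_add_le (x : ℝ) {e : ℝ} (he : 0 ≤ e) : gaussCdf (x + e) ≤ gaussCdf x + e := by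
  rw [gaussCdf_eq, gaussCdf_eq, ← Set.Iic_union_Ioc_eq_Iic (by linarith : x ≤ x + e)]
  refine (measureReal_union_le _ _).trans ?_
  gcongr
  rw [measureReal_def, gaussianReal_apply_eq_integral _ (by norm_num),
    ENNReal.toReal_ofReal (integral_nonneg fun t => gaussianPDFReal_nonneg _ _ _)]
  have hle : ∀ t, gaussianPDFReal 0 1 t ≤ 1 := fun t => by
    have h1 : Real.exp (-t ^ 2 / 2) ≤ 1 := by
      rw [Real.exp_le_one_iff]; nlinarith [sq_nonneg t]
    have h2 : (√(2 * Real.pi))⁻¹ ≤ 1 := by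
      refine inv_le_one_of_one_le₀ (Real.one_le_sqrt.2 ?_)
      linarith [Real.pi_gt_three]
    have := mul_le_mul h2 h1 (Real.exp_nonneg _) zero_le_one
    simpa [gaussianPDFReal] using this
  calc ∫ t in Set.Ioc x (x + e), gaussianPDFReal 0 1 t
      ≤ ∫ t in Set.Ioc x (x + e), (1 : ℝ) :=
        setIntegral_mono (integrable_gaussianPDFReal _ _).integrableOn (by simp) hle
    _ = e := by simp [he]

/-- A smoothed half-line indicator is sandwiched between two distribution function values. -/
theorem integral_step_mem_cdf_Icc {φ : ℝ → ℝ} (hc : Continuous φ)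
    (h0 : ∀ t, 0 ≤ φ t) (h1 : ∀ t, φ t ≤ 1) (hl : ∀ t ≤ 0, φ t = 1) (hr : ∀ t, 1 ≤ t → φ t = 0)
    {e : ℝ} (he : 0 < e) {α : Type*} [MeasurableSpace α] (ρ : Measure α) [IsProbabilityMeasure ρ]
    {F : α → ℝ} (hF : AEMeasurable F ρ) (y : ℝ) :
    ρ.real {s | F s ≤ y} ≤ ∫ s, φ ((F s - y) / e) ∂ρ ∧
      ∫ s, φ ((F s - y) / e) ∂ρ ≤ ρ.real {s | F s ≤ y + e} := by
  have hm : ∀ z, NullMeasurableSet {s | F s ≤ z} ρ := fun z =>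
    nullMeasurableSet_le hF aemeasurable_const
  have hi : Integrable (fun s => φ ((F s - y) / e)) ρ :=
    hc.integrable_comp_of_bounded (fun t => abs_le.2 ⟨by linarith [h0 t], h1 t⟩) ρ
      (fun s => (F s - y) / e) ((hF.sub_const y).div_const e)
  have hind : ∀ z, ρ.real {s | F s ≤ z} = ∫ s, {s | F s ≤ z}.indicator 1 s ∂ρ := fun z => by
    rw [integral_indicator₀ (hm z)]; simp
  rw [hind y, hind (y + e)]
  constructor
  · refine integral_mono ((integrable_const _).indicator₀ (hm y)) hi fun s => ?_
    by_cases hs : F s ≤ y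
    · simp only [Set.indicator, Set.mem_ofPred_eq, hs, if_true, Pi.one_apply]
      rw [hl]
      exact div_nonpos_of_nonpos_of_nonneg (by linarith) he.le
    · simp [Set.indicator, hs, h0]
  · refine integral_mono hi ((integrable_const _).indicator₀ (hm (y + e))) fun s => ?_
    by_cases hs : F s ≤ y + e
    · simp [Set.indicator, hs, h1]
    · simp only [Set.indicator, Set.mem_ofPred_eq, hs, if_false]
      rw [hr]
      rw [le_div_iff₀ he]; linarith

/-- A uniform smoothing inequality: closeness on smoothed half-lines gives closeness of
distribution functions. -/
theorem abs_cdf_sub_gaussCdf_le {Ω : Type*} [MeasurableSpace Ω] (P : Measure Ω)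
    [IsProbabilityMeasure P] {T : Ω → ℝ} (hT : AEMeasurable T P) {φ : ℝ → ℝ} (hc : Continuous φ)
    (h0 : ∀ t, 0 ≤ φ t) (h1 : ∀ t, φ t ≤ 1) (hl : ∀ t ≤ 0, φ t = 1) (hr : ∀ t, 1 ≤ t → φ t = 0)
    {e c : ℝ} (he : 0 < e)
    (H : ∀ y, |∫ ω, φ ((T ω - y) / e) ∂P - ∫ t, φ ((t - y) / e) ∂(gaussianReal 0 1)| ≤ c)
    (x : ℝ) : |(P {ω | T ω ≤ x}).toReal - gaussCdf x| ≤ e + c := by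
  have a1 := (integral_step_mem_cdf_Icc hc h0 h1 hl hr he P hT x).1
  have a2 := (integral_step_mem_cdf_Icc hc h0 h1 hl hr he P hT (x - e)).2
  have g1 := (integral_step_mem_cdf_Icc hc h0 h1 hl hr he (gaussianReal 0 1) (F := fun t => t)
    aemeasurable_id x).2
  have g2 := (integral_step_mem_cdf_Icc hc h0 h1 hl hr he (gaussianReal 0 1) (F := fun t => t)
    aemeasurable_id (x - e)).1
  change _ ≤ (gaussianReal 0 1).real (Set.Iic (x + e)) at g1
  change (gaussianReal 0 1).real (Set.Iic (x - e)) ≤ _ at g2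
  rw [← gaussCdf_eq] at g1 g2
  have l1 := gaussCdf_add_le x he.le
  have l2 := gaussCdf_add_le (x - e) he.le
  have H1 := abs_le.1 (H x)
  have H2 := abs_le.1 (H (x - e))
  rw [sub_add_cancel] at a2 l2
  rw [← measureReal_def, abs_le]
  constructor <;> linarith [H1.1, H1.2, H2.1, H2.2]

open scoped NNReal in
theorem abs_integral_step_sum_sub_gaussian_le {S : Type*} [MeasurableSpace S] (μ : Measure S)
    [IsProbabilityMeasure μ] {g : S → ℝ} (hgm : Measurable g) (hg3 : MemLp g 3 μ)
    (h0 : ∫ s, g s ∂μ = 0) {v : ℝ≥0} (hv : ∫ s, g s ^ 2 ∂μ = v) (hvpos : 0 < v)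
    {φ : ℝ → ℝ} (hc : Continuous φ) (hb : ∀ t, |φ t| ≤ 1) {K : ℝ}
    (hT : CubicTaylorBound K φ) {n : ℕ} (hn : 0 < n) {e : ℝ} (he : 0 < e) (y : ℝ) :
    |∫ x : Fin n → S, φ (((∑ i, g (x i)) / (√v * √n) - y) / e) ∂(Measure.pi fun _ => μ)
      - ∫ t, φ ((t - y) / e) ∂(gaussianReal 0 1)|
      ≤ (K * ∫ s, |g s| ^ 3 ∂μ + K * ∫ t, |t| ^ 3 ∂(gaussianReal 0 v)) / √v ^ 3 /
        (e ^ 3 * √n) := by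
  have hsv : 0 < √(v : ℝ) := Real.sqrt_pos.2 (by exact_mod_cast hvpos)
  have hsn : 0 < √(n : ℝ) := Real.sqrt_pos.2 (by exact_mod_cast hn)
  set c : ℝ := (√v * √n * e)⁻¹ with hcdef
  have hcpos : 0 < c := by positivity
  have key := abs_integral_sum_sub_gaussian_le μ hgm hg3 h0 hv
    (h := fun t => φ (c * t + -y / e)) (by fun_prop) (fun t => hb _)
    (hT.comp_affine c (-y / e)) n 0
  have hmap : gaussianReal 0 1 = (gaussianReal 0 (n * v)).map (fun t => t / (√v * √n)) := by
    rw [gaussianReal_map_div_const]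
    congr 1
    · simp
    · rw [eq_div_iff]
      · rw [one_mul]; ext; push_cast
        rw [mul_pow, Real.sq_sqrt (by positivity), Real.sq_sqrt (by positivity)]
        simp [mul_comm]
      · intro h
        have := congrArg NNReal.toReal h
        simp at this
        rcases this with h | h <;> simp_all
  rw [hmap, integral_map (by fun_prop) (by
    have : Measurable φ := hc.measurable
    exact (by fun_prop : Measurable fun t => φ ((t - y) / e)).aestronglyMeasurable)]
  have ha : ∀ t, φ (c * (0 + t) + -y / e) = φ ((t / (√v * √n) - y) / e) := fun t => by
    congr 1; rw [hcdef]; field_simp; ring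
  simp only [ha] at key
  refine key.trans (le_of_eq ?_)
  rw [abs_of_pos hcpos, hcdef]
  have : (n : ℝ) = √n ^ 2 := by rw [Real.sq_sqrt]; positivity
  nth_rewrite 1 [this]
  field_simp

section Resample

variable {ι κ α : Type*}

open Classical in
/-- Replace the coordinates `e m`, `m ∈ A`, of the family `x` by `z m`. -/
noncomputable def resample (e : κ → ι) (A : Set κ) (x : ι → α) (z : κ → α) : ι → α :=
  fun j => if h : ∃ m ∈ A, e m = j then z h.choose else x j

theorem resample_apply_of_mem {e : κ → ι} (he : Function.Injective e) {A : Set κ} (x : ι → α)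
    (z : κ → α) {m : κ} (hm : m ∈ A) : resample e A x z (e m) = z m := by
  have h : ∃ m' ∈ A, e m' = e m := ⟨m, hm, rfl⟩
  rw [resample, dif_pos h, he h.choose_spec.2]

theorem resample_apply_of_notMem {e : κ → ι} {A : Set κ} (x : ι → α) (z : κ → α) {j : ι}
    (hj : ∀ m ∈ A, e m ≠ j) : resample e A x z j = x j := by
  rw [resample, dif_neg]
  rintro ⟨m, hm, h⟩
  exact hj m hm h

theorem measurePreserving_comp_injective [Fintype ι] [Fintype κ] [MeasurableSpace α]
    (μ : Measure α) [IsProbabilityMeasure μ] {s : ι → κ} (hs : Function.Injective s) :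
    MeasurePreserving (fun (u : κ → α) i => u (s i)) (Measure.pi fun _ => μ)
      (Measure.pi fun _ => μ) := by
  refine ⟨by fun_prop, ?_⟩
  have h : iIndepFun (fun (i : κ) (u : κ → α) => u i) (Measure.pi fun _ : κ => μ) :=
    iIndepFun_pi (X := fun _ => id) fun _ => aemeasurable_id
  have h2 := h.precomp hs
  rw [iIndepFun_iff_map_fun_eq_pi_map (fun i => (measurable_pi_apply (s i)).aemeasurable)] at h2
  refine h2.trans ?_
  congr 1
  ext1 i
  exact (measurePreserving_eval (fun _ : κ => μ) (s i)).map_eq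

theorem measurePreserving_resample [Fintype ι] [Fintype κ] [MeasurableSpace α]
    (μ : Measure α) [IsProbabilityMeasure μ] (e : κ → ι) (A : Set κ) :
    MeasurePreserving (fun p : (ι → α) × (κ → α) => resample e A p.1 p.2)
      ((Measure.pi fun _ => μ).prod (Measure.pi fun _ => μ)) (Measure.pi fun _ => μ) := by
  classical
  let s : ι → ι ⊕ κ := fun j => if h : ∃ m ∈ A, e m = j then Sum.inr h.choose else Sum.inl j
  have hs : Function.Injective s := by
    intro i j hij
    simp only [s] at hij
    split_ifs at hij with h1 h2 h2
    · have := Sum.inr_injective hij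
      rw [← h1.choose_spec.2, ← h2.choose_spec.2, this]
    · exact Sum.inl_injective hij
  have h1 := measurePreserving_comp_injective μ hs
  have h2 := measurePreserving_sumPiEquivProdPi_symm (fun _ : ι ⊕ κ => μ)
  have h3 := h1.comp h2
  convert h3 using 1
  ext p j
  simp only [resample, Function.comp, s]
  split_ifs <;> rfl

end Resample

/-- The unordered pair `{β q.1, β q.2}`, listed increasingly. -/
def pairIdx {k n : ℕ} (β : Fin k ↪ Fin n) (q : {q : Fin k × Fin k // q.1 < q.2}) :
    {q : Fin n × Fin n // q.1 < q.2} :=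
  if h : β q.1.1 < β q.1.2 then ⟨(β q.1.1, β q.1.2), h⟩
  else ⟨(β q.1.2, β q.1.1), lt_of_le_of_ne (not_lt.1 h) fun h' => q.2.ne' (β.injective h')⟩

theorem pairIdx_eq_imp {k n : ℕ} {β β' : Fin k ↪ Fin n}
    {q q' : {q : Fin k × Fin k // q.1 < q.2}} (h : pairIdx β q = pairIdx β' q') :
    (β q.1.1 = β' q'.1.1 ∧ β q.1.2 = β' q'.1.2) ∨ (β q.1.1 = β' q'.1.2 ∧ β q.1.2 = β' q'.1.1) := by
  unfold pairIdx at h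
  split_ifs at h <;> simp only [Subtype.mk.injEq, Prod.mk.injEq] at h <;> tauto

theorem pairIdx_injective {k n : ℕ} (β : Fin k ↪ Fin n) : Function.Injective (pairIdx β) := by
  intro q q' h
  rcases pairIdx_eq_imp h with ⟨h1, h2⟩ | ⟨h1, h2⟩
  · exact Subtype.ext (Prod.ext (β.injective h1) (β.injective h2))
  · have h1 := β.injective h1
    have h2 := β.injective h2
    have := q.2
    rw [h1, h2] at this
    exact absurd q'.2 this.asymm

theorem genU_eq_sum_embedding {S M Ω : Type*} {k n : ℕ}
    (f : (Fin k → S) → ({q : Fin k × Fin k // q.1 < q.2} → M) → ℝ)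
    (X : Fin n → Ω → S) (Y : Fin n → Fin n → Ω → M) (hY : ∀ a b, Y a b = Y b a) (ω : Ω) :
    genU f X Y ω = ∑ β : Fin k ↪ Fin n, f (fun i => X (β i) ω)
      (fun q => Y (pairIdx β q).1.1 (pairIdx β q).1.2 ω) := by
  rw [genU, ← Finset.sum_subtype_eq_sum_filter, Finset.subtype_univ]
  refine Fintype.sum_equiv (Equiv.subtypeInjectiveEquivEmbedding _ _) _ _ fun β => ?_
  congr 1
  ext q
  unfold pairIdx
  split_ifs
  · rfl
  · rw [hY]; rfl

theorem integrable_of_measurable_bounded {α : Type*} [MeasurableSpace α] {ρ : Measure α}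
    [IsFiniteMeasure ρ] {F : α → ℝ} (hF : Measurable F) {B : ℝ} (hB : ∀ a, |F a| ≤ B) :
    Integrable F ρ :=
  Integrable.of_bound hF.aestronglyMeasurable B (ae_of_all _ hB)

theorem resample_comp_embedding {S : Type*} {k n : ℕ} (β : Fin k ↪ Fin n) (ℓ : Fin k)
    (x : Fin n → S) (z : Fin k → S) :
    (fun i => resample β {ℓ}ᶜ x z (β i)) = Function.update z ℓ (x (β ℓ)) := by
  ext i
  rcases eq_or_ne i ℓ with rfl | hi
  · rw [Function.update_self, resample_apply_of_notMem]
    exact fun m hm h => hm (β.injective h)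
  · rw [Function.update_of_ne hi, resample_apply_of_mem β.injective _ _ hi]

section Orthogonality

variable {S M : Type*} [MeasurableSpace S] [MeasurableSpace M] {k n : ℕ}

/-- A kernel whose one-coordinate projections vanish is orthogonal to every function of the
coordinates that it does not use, up to one index. -/
theorem integral_mul_block_eq_zero (μ : Measure S) [IsProbabilityMeasure μ]
    (Q : Measure M) [IsProbabilityMeasure Q]
    {r : (Fin k → S) → ({q : Fin k × Fin k // q.1 < q.2} → M) → ℝ}
    (hrm : Measurable fun z : (Fin k → S) × ({q : Fin k × Fin k // q.1 < q.2} → M) => r z.1 z.2)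
    {B : ℝ} (hB : ∀ x y, |r x y| ≤ B) (ℓ : Fin k)
    (hr : ∀ s, ∫ z : (Fin k → S) × ({q : Fin k × Fin k // q.1 < q.2} → M),
      r (Function.update z.1 ℓ s) z.2
        ∂((Measure.pi fun _ => μ).prod (Measure.pi fun _ => Q)) = 0)
    (β : Fin k ↪ Fin n)
    {F : (Fin n → S) → ({q : Fin n × Fin n // q.1 < q.2} → M) → ℝ}
    (hFm : Measurable fun z : (Fin n → S) × ({q : Fin n × Fin n // q.1 < q.2} → M) => F z.1 z.2)
    {B' : ℝ} (hB' : ∀ x y, |F x y| ≤ B')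
    (hF : ∀ x y z w, F (resample β {ℓ}ᶜ x z) (resample (pairIdx β) Set.univ y w) = F x y) :
    ∫ p : (Fin n → S) × ({q : Fin n × Fin n // q.1 < q.2} → M),
      F p.1 p.2 * r (fun i => p.1 (β i)) (fun q => p.2 (pairIdx β q))
        ∂((Measure.pi fun _ => μ).prod (Measure.pi fun _ => Q)) = 0 := by
  have mp := (measurePreserving_resample μ β {ℓ}ᶜ).prod
    (measurePreserving_resample Q (pairIdx β) Set.univ)
  have hGm : Measurable fun p : (Fin n → S) × ({q : Fin n × Fin n // q.1 < q.2} → M) =>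
      F p.1 p.2 * r (fun i => p.1 (β i)) (fun q => p.2 (pairIdx β q)) :=
    hFm.mul (hrm.comp (by fun_prop : Measurable
      fun p : (Fin n → S) × ({q : Fin n × Fin n // q.1 < q.2} → M) =>
        ((fun i => p.1 (β i)), (fun q => p.2 (pairIdx β q)))))
  have hGb : ∀ a b, |a| ≤ B' → |b| ≤ B → |a * b| ≤ B' * B := fun a b ha hb => by
    rw [abs_mul]; exact mul_le_mul ha hb (abs_nonneg _) ((abs_nonneg _).trans ha)
  rw [← mp.map_eq, integral_map mp.measurable.aemeasurable hGm.aestronglyMeasurable]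
  have hval : ∀ p : ((Fin n → S) × (Fin k → S)) × (({q : Fin n × Fin n // q.1 < q.2} → M) ×
      ({q : Fin k × Fin k // q.1 < q.2} → M)),
      F (resample β {ℓ}ᶜ p.1.1 p.1.2) (resample (pairIdx β) Set.univ p.2.1 p.2.2) *
        r (fun i => resample β {ℓ}ᶜ p.1.1 p.1.2 (β i))
          (fun q => resample (pairIdx β) Set.univ p.2.1 p.2.2 (pairIdx β q)) =
      F p.1.1 p.2.1 * r (Function.update p.1.2 ℓ (p.1.1 (β ℓ))) p.2.2 := fun p => by
    rw [hF, resample_comp_embedding]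
    congr 2
    ext q
    exact resample_apply_of_mem (pairIdx_injective β) _ _ trivial
  have hGm' := hGm.comp mp.measurable
  simp only [Function.comp_def, Prod.map] at hGm' ⊢
  simp only [hval] at hGm' ⊢
  have hi := integrable_of_measurable_bounded
    (ρ := (((Measure.pi fun _ : Fin n => μ).prod (Measure.pi fun _ : Fin k => μ)).prod
      ((Measure.pi fun _ : {q : Fin n × Fin n // q.1 < q.2} => Q).prod
        (Measure.pi fun _ : {q : Fin k × Fin k // q.1 < q.2} => Q))))
    hGm' (fun p => hGb _ _ (hB' _ _) (hB _ _))
  rw [integral_prod _ hi, integral_prod _ hi.integral_prod_left]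
  refine integral_eq_zero_of_ae (ae_of_all _ fun x => ?_)
  have hm1 : Measurable fun t : (Fin k → S) × (({q : Fin n × Fin n // q.1 < q.2} → M) ×
      ({q : Fin k × Fin k // q.1 < q.2} → M)) =>
      F x t.2.1 * r (Function.update t.1 ℓ (x (β ℓ))) t.2.2 :=
    hGm'.comp (by fun_prop : Measurable fun t : (Fin k → S) ×
      (({q : Fin n × Fin n // q.1 < q.2} → M) × ({q : Fin k × Fin k // q.1 < q.2} → M)) =>
        ((x, t.1), t.2))
  have e1 : ∀ z : Fin k → S,
      ∫ t : ({q : Fin n × Fin n // q.1 < q.2} → M) × ({q : Fin k × Fin k // q.1 < q.2} → M),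
        F x t.1 * r (Function.update z ℓ (x (β ℓ))) t.2
          ∂((Measure.pi fun _ => Q).prod (Measure.pi fun _ => Q)) =
      (∫ y, F x y ∂(Measure.pi fun _ => Q)) *
        ∫ w, r (Function.update z ℓ (x (β ℓ))) w ∂(Measure.pi fun _ => Q) := fun z =>
    integral_prod_mul _ _
  simp only [e1, integral_const_mul, Pi.zero_apply]
  have e2 := hr (x (β ℓ))
  rw [integral_prod] at e2
  · rw [e2, mul_zero]
  · exact integrable_of_measurable_bounded (hrm.comp (by fun_prop : Measurable
      fun z : (Fin k → S) × ({q : Fin k × Fin k // q.1 < q.2} → M) =>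
        (Function.update z.1 ℓ (x (β ℓ)), z.2))) (fun z => hB _ _)

end Orthogonality

section Hoeffding

variable {S M : Type*} [MeasurableSpace S] [MeasurableSpace M] {k n : ℕ}

theorem fProj_measurable (μ : Measure S) [IsProbabilityMeasure μ]
    (Q : Measure M) [IsProbabilityMeasure Q]
    {f : (Fin k → S) → ({q : Fin k × Fin k // q.1 < q.2} → M) → ℝ}
    (hf : Measurable fun z : (Fin k → S) × ({q : Fin k × Fin k // q.1 < q.2} → M) => f z.1 z.2)
    (ℓ : Fin k) : Measurable (fProj f μ Q ℓ) := by
  have : Measurable fun t : S × ((Fin k → S) × ({q : Fin k × Fin k // q.1 < q.2} → M)) =>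
      f (Function.update t.2.1 ℓ t.1) t.2.2 :=
    hf.comp (by fun_prop : Measurable
      fun t : S × ((Fin k → S) × ({q : Fin k × Fin k // q.1 < q.2} → M)) =>
        (Function.update t.2.1 ℓ t.1, t.2.2))
  exact this.stronglyMeasurable.integral_prod_right.measurable

theorem abs_fProj_le (μ : Measure S) [IsProbabilityMeasure μ]
    (Q : Measure M) [IsProbabilityMeasure Q]
    {f : (Fin k → S) → ({q : Fin k × Fin k // q.1 < q.2} → M) → ℝ}
    {C₀ : ℝ} (hC₀ : ∀ x y, |f x y| ≤ C₀) (ℓ : Fin k) (s : S) : |fProj f μ Q ℓ s| ≤ C₀ := by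
  rw [fProj, ← Real.norm_eq_abs]
  exact (norm_integral_le_of_norm_le_const (C := C₀) (ae_of_all _ fun z => hC₀ _ _)).trans
    (by simp)

/-- The mean of a kernel. -/
noncomputable def kernelMean (f : (Fin k → S) → ({q : Fin k × Fin k // q.1 < q.2} → M) → ℝ)
    (μ : Measure S) (Q : Measure M) : ℝ :=
  ∫ z : (Fin k → S) × ({q : Fin k × Fin k // q.1 < q.2} → M), f z.1 z.2
    ∂((Measure.pi fun _ => μ).prod (Measure.pi fun _ => Q))

theorem abs_kernelMean_le (μ : Measure S) [IsProbabilityMeasure μ]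
    (Q : Measure M) [IsProbabilityMeasure Q]
    {f : (Fin k → S) → ({q : Fin k × Fin k // q.1 < q.2} → M) → ℝ}
    {C₀ : ℝ} (hC₀ : ∀ x y, |f x y| ≤ C₀) : |kernelMean f μ Q| ≤ C₀ := by
  rw [kernelMean, ← Real.norm_eq_abs]
  exact (norm_integral_le_of_norm_le_const (C := C₀) (ae_of_all _ fun z => hC₀ _ _)).trans
    (by simp)

theorem integral_fProj (μ : Measure S) [IsProbabilityMeasure μ]
    (Q : Measure M) [IsProbabilityMeasure Q]
    {f : (Fin k → S) → ({q : Fin k × Fin k // q.1 < q.2} → M) → ℝ}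
    (hf : Measurable fun z : (Fin k → S) × ({q : Fin k × Fin k // q.1 < q.2} → M) => f z.1 z.2)
    {C₀ : ℝ} (hC₀ : ∀ x y, |f x y| ≤ C₀) (ℓ : Fin k) :
    ∫ s, fProj f μ Q ℓ s ∂μ = kernelMean f μ Q := by
  set G : (Fin k → S) → ℝ := fun z => ∫ w, f z w ∂(Measure.pi fun _ => Q) with hG
  have hGm : StronglyMeasurable G := hf.stronglyMeasurable.integral_prod_right
  have hGb : ∀ z, |G z| ≤ C₀ := fun z => by
    rw [hG, ← Real.norm_eq_abs]
    exact (norm_integral_le_of_norm_le_const (C := C₀) (ae_of_all _ fun w => hC₀ _ _)).trans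
      (by simp)
  have h1 : ∫ s, fProj f μ Q ℓ s ∂μ =
      ∫ x : Fin k → S, fProj f μ Q ℓ (x ℓ) ∂(Measure.pi fun _ => μ) :=
    (integral_comp_eval (μ := fun _ : Fin k => μ) (i := ℓ)
      (fProj_measurable μ Q hf ℓ).aestronglyMeasurable).symm
  have h2 : ∀ s, fProj f μ Q ℓ s = ∫ z, G (Function.update z ℓ s) ∂(Measure.pi fun _ => μ) :=
    fun s => by
      rw [fProj, integral_prod]
      exact integrable_of_measurable_bounded (hf.comp (by fun_prop : Measurable
        fun z : (Fin k → S) × ({q : Fin k × Fin k // q.1 < q.2} → M) =>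
          (Function.update z.1 ℓ s, z.2))) fun z => hC₀ _ _
  have mp := measurePreserving_resample μ (id : Fin k → Fin k) {ℓ}
  have hres : (fun p : (Fin k → S) × (Fin k → S) => resample id {ℓ} p.1 p.2) =
      fun p => Function.update p.1 ℓ (p.2 ℓ) := by
    ext p i
    rcases eq_or_ne i ℓ with rfl | hi
    · rw [Function.update_self]
      exact resample_apply_of_mem Function.injective_id p.1 p.2 rfl
    · rw [Function.update_of_ne hi, resample_apply_of_notMem]
      rintro m rfl
      exact hi.symm
  rw [hres] at mp
  have h3 : kernelMean f μ Q = ∫ z, G z ∂(Measure.pi fun _ => μ) := by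
    rw [kernelMean, integral_prod]
    exact integrable_of_measurable_bounded hf fun z => hC₀ _ _
  have h4 := integral_map (μ := (Measure.pi fun _ : Fin k => μ).prod (Measure.pi fun _ : Fin k => μ))
    mp.measurable.aemeasurable hGm.aestronglyMeasurable
  rw [mp.map_eq] at h4
  rw [h1, h3, h4, integral_prod_symm]
  · simp only [h2]
  · exact integrable_of_measurable_bounded (hGm.measurable.comp mp.measurable) fun z => hGb _

/-- The part of a kernel that is left after removing its mean and its one-coordinate
projections. -/
noncomputable def kernelRem (f : (Fin k → S) → ({q : Fin k × Fin k // q.1 < q.2} → M) → ℝ)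
    (μ : Measure S) (Q : Measure M) (x : Fin k → S) (y : {q : Fin k × Fin k // q.1 < q.2} → M) :
    ℝ :=
  f x y - kernelMean f μ Q - ∑ ℓ, (fProj f μ Q ℓ (x ℓ) - kernelMean f μ Q)

theorem kernelRem_measurable (μ : Measure S) [IsProbabilityMeasure μ]
    (Q : Measure M) [IsProbabilityMeasure Q]
    {f : (Fin k → S) → ({q : Fin k × Fin k // q.1 < q.2} → M) → ℝ}
    (hf : Measurable fun z : (Fin k → S) × ({q : Fin k × Fin k // q.1 < q.2} → M) => f z.1 z.2) :
    Measurable fun z : (Fin k → S) × ({q : Fin k × Fin k // q.1 < q.2} → M) =>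
      kernelRem f μ Q z.1 z.2 := by
  have := fProj_measurable μ Q hf
  unfold kernelRem
  fun_prop

theorem abs_kernelRem_le (μ : Measure S) [IsProbabilityMeasure μ]
    (Q : Measure M) [IsProbabilityMeasure Q]
    {f : (Fin k → S) → ({q : Fin k × Fin k // q.1 < q.2} → M) → ℝ}
    {C₀ : ℝ} (hC₀ : ∀ x y, |f x y| ≤ C₀) (x : Fin k → S)
    (y : {q : Fin k × Fin k // q.1 < q.2} → M) : |kernelRem f μ Q x y| ≤ 2 * (k + 1) * C₀ := by
  have hθ := abs_kernelMean_le μ Q hC₀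
  have h1 : |f x y - kernelMean f μ Q| ≤ 2 * C₀ :=
    (abs_sub _ _).trans (by linarith [hC₀ x y])
  have h2 : |∑ ℓ, (fProj f μ Q ℓ (x ℓ) - kernelMean f μ Q)| ≤ k * (2 * C₀) := by
    refine (Finset.abs_sum_le_sum_abs _ _).trans ?_
    refine (Finset.sum_le_card_nsmul _ _ (2 * C₀) fun ℓ _ =>
      (abs_sub _ _).trans (by linarith [abs_fProj_le μ Q hC₀ ℓ (x ℓ)])).trans ?_
    simp
  exact (abs_sub _ _).trans (by linarith)

theorem integral_kernelRem_update (μ : Measure S) [IsProbabilityMeasure μ]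
    (Q : Measure M) [IsProbabilityMeasure Q]
    {f : (Fin k → S) → ({q : Fin k × Fin k // q.1 < q.2} → M) → ℝ}
    (hf : Measurable fun z : (Fin k → S) × ({q : Fin k × Fin k // q.1 < q.2} → M) => f z.1 z.2)
    {C₀ : ℝ} (hC₀ : ∀ x y, |f x y| ≤ C₀) (ℓ : Fin k) (s : S) :
    ∫ z : (Fin k → S) × ({q : Fin k × Fin k // q.1 < q.2} → M),
      kernelRem f μ Q (Function.update z.1 ℓ s) z.2
        ∂((Measure.pi fun _ => μ).prod (Measure.pi fun _ => Q)) = 0 := by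
  have hp := fProj_measurable μ Q hf
  have hup : Measurable fun z : (Fin k → S) × ({q : Fin k × Fin k // q.1 < q.2} → M) =>
      (Function.update z.1 ℓ s, z.2) := by fun_prop
  have i1 : Integrable (fun z : (Fin k → S) × ({q : Fin k × Fin k // q.1 < q.2} → M) =>
      f (Function.update z.1 ℓ s) z.2) ((Measure.pi fun _ => μ).prod (Measure.pi fun _ => Q)) :=
    integrable_of_measurable_bounded (hf.comp hup) fun z => hC₀ _ _
  have i2 : ∀ m, Integrable (fun z : (Fin k → S) × ({q : Fin k × Fin k // q.1 < q.2} → M) =>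
      fProj f μ Q m (Function.update z.1 ℓ s m) - kernelMean f μ Q)
      ((Measure.pi fun _ => μ).prod (Measure.pi fun _ => Q)) := fun m =>
    (integrable_of_measurable_bounded ((hp m).comp (((measurable_pi_apply m).comp
      measurable_fst).comp hup)) fun z => abs_fProj_le μ Q hC₀ m _).sub (integrable_const _)
  unfold kernelRem
  have i3 : Integrable (fun z : (Fin k → S) × ({q : Fin k × Fin k // q.1 < q.2} → M) =>
      f (Function.update z.1 ℓ s) z.2 - kernelMean f μ Q)
      ((Measure.pi fun _ => μ).prod (Measure.pi fun _ => Q)) := i1.sub (integrable_const _)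
  rw [integral_sub i3 (integrable_finsetSum _ fun m _ => i2 m),
    integral_sub i1 (integrable_const _), integral_finsetSum _ fun m _ => i2 m,
    Finset.sum_eq_single ℓ]
  · simp [fProj]
  · intro m _ hm
    have i4 : Integrable (fProj f μ Q m) μ :=
      integrable_of_measurable_bounded (hp m) (abs_fProj_le μ Q hC₀ m)
    have i5 : Integrable (fun s => fProj f μ Q m s - kernelMean f μ Q) μ :=
      i4.sub (integrable_const _)
    simp only [Function.update_of_ne hm]
    rw [integral_fun_fst (fun z : Fin k → S => fProj f μ Q m (z m) - kernelMean f μ Q),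
      integral_comp_eval (μ := fun _ : Fin k => μ) (i := m)
        (f := fun s => fProj f μ Q m s - kernelMean f μ Q) i5.1,
      integral_sub i4 (integrable_const _), integral_fProj μ Q hf hC₀]
    simp
  · simp

end Hoeffding

section SecondMoments

variable {k n : ℕ}

/-- The number of embeddings with a prescribed value at one point does not depend on the point
or on the value. -/
theorem card_mul_card_embedding_apply_eq (ℓ : Fin k) (i : Fin n) :
    n * #{β : Fin k ↪ Fin n | β ℓ = i} = n.descFactorial k := by
  have h : ∀ j : Fin n, #{β : Fin k ↪ Fin n | β ℓ = j} = #{β : Fin k ↪ Fin n | β ℓ = i} := by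
    intro j
    refine Finset.card_bij' (fun β _ => β.trans (Equiv.swap i j).toEmbedding)
      (fun β _ => β.trans (Equiv.swap i j).toEmbedding) ?_ ?_ ?_ ?_ <;>
    · intro β hβ
      simp at hβ
      first
        | simp [hβ]
        | (ext x; simp)
  have h2 := Finset.card_eq_sum_card_fiberwise (s := (Finset.univ : Finset (Fin k ↪ Fin n)))
    (t := (Finset.univ : Finset (Fin n))) (f := fun β => β ℓ) (by simp)
  simp only [h, Finset.sum_const, Finset.card_univ, Fintype.card_fin, smul_eq_mul,
    Fintype.card_embedding_eq] at h2
  exact h2.symm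

/-- The pairs of embeddings whose images share at least two indices. -/
noncomputable def overlappingPairs (k n : ℕ) : Finset ((Fin k ↪ Fin n) × (Fin k ↪ Fin n)) :=
  {p | ∃ a b a' b', a ≠ b ∧ p.1 a = p.2 a' ∧ p.1 b = p.2 b'}

theorem card_overlappingPairs_le (hk : 2 ≤ k) :
    #(overlappingPairs k n) ≤ k ^ 4 * n ^ (2 * k - 2) := by
  have h1 : overlappingPairs k n ⊆ (Finset.univ : Finset (Fin k × Fin k × Fin k × Fin k)).biUnion
      fun t => {p | t.1 ≠ t.2.1 ∧ p.1 t.1 = p.2 t.2.2.1 ∧ p.1 t.2.1 = p.2 t.2.2.2} := by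
    intro p hp
    simp only [overlappingPairs, Finset.mem_filter, Finset.mem_univ, true_and] at hp
    obtain ⟨a, b, a', b', h⟩ := hp
    simp only [Finset.mem_biUnion, Finset.mem_univ, true_and, Finset.mem_filter]
    exact ⟨(a, b, a', b'), h⟩
  refine (Finset.card_le_card h1).trans ((Finset.card_biUnion_le_card_mul _ _ (n ^ (2 * k - 2))
    ?_).trans (le_of_eq (by simp; left; ring)))
  rintro ⟨a, b, a', b'⟩ -
  simp only
  by_cases hab : a' = b'
  · rw [Finset.card_eq_zero.2]
    · exact Nat.zero_le _
    · rw [Finset.filter_eq_empty_iff]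
      rintro p - ⟨h1, h2, h3⟩
      exact h1 (p.1.injective (by rw [h2, h3, hab]))
  have hcard : Fintype.card ((Fin k → Fin n) × ({m : Fin k // m ≠ a' ∧ m ≠ b'} → Fin n)) =
      n ^ (2 * k - 2) := by
    have : Fintype.card {m : Fin k // m ≠ a' ∧ m ≠ b'} = k - 2 := by
      rw [Fintype.card_subtype]
      have : ({m : Fin k | m ≠ a' ∧ m ≠ b'} : Finset (Fin k)) = ({a', b'} : Finset (Fin k))ᶜ := by
        ext m; simp
      rw [this, Finset.card_compl, Finset.card_pair hab, Fintype.card_fin]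
    rw [Fintype.card_prod, Fintype.card_fun, Fintype.card_fun, this]
    simp only [Fintype.card_fin]
    rw [← pow_add]; congr 1; omega
  rw [← hcard, ← Finset.card_univ]
  refine Finset.card_le_card_of_injOn (fun p => (p.1, fun m => p.2 m.1)) (by simp) ?_
  rintro ⟨p, p'⟩ hp ⟨q, q'⟩ hq hpq
  simp only [Finset.coe_filter, Finset.mem_univ, true_and, Set.mem_ofPred_eq, Prod.mk.injEq]
    at hp hq hpq
  have e1 : p = q := DFunLike.coe_injective hpq.1
  subst e1
  congr 1
  ext m
  by_cases hm : m = a'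
  · rw [hm, ← hp.2.1, ← hq.2.1]
  by_cases hm' : m = b'
  · rw [hm', ← hp.2.2, ← hq.2.2]
  exact congrArg Fin.val (congrFun hpq.2 ⟨m, hm, hm'⟩)

variable {S M : Type*} [MeasurableSpace S] [MeasurableSpace M]

theorem measurable_block {r : (Fin k → S) → ({q : Fin k × Fin k // q.1 < q.2} → M) → ℝ}
    (hrm : Measurable fun z : (Fin k → S) × ({q : Fin k × Fin k // q.1 < q.2} → M) => r z.1 z.2)
    (β : Fin k ↪ Fin n) :
    Measurable fun p : (Fin n → S) × ({q : Fin n × Fin n // q.1 < q.2} → M) =>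
      r (fun i => p.1 (β i)) (fun q => p.2 (pairIdx β q)) :=
  hrm.comp (by fun_prop : Measurable
      fun p : (Fin n → S) × ({q : Fin n × Fin n // q.1 < q.2} → M) =>
        ((fun i => p.1 (β i)), (fun q => p.2 (pairIdx β q))))

theorem integral_block_mul_block_eq_zero (hk : 2 ≤ k) (μ : Measure S) [IsProbabilityMeasure μ]
    (Q : Measure M) [IsProbabilityMeasure Q]
    {r : (Fin k → S) → ({q : Fin k × Fin k // q.1 < q.2} → M) → ℝ}
    (hrm : Measurable fun z : (Fin k → S) × ({q : Fin k × Fin k // q.1 < q.2} → M) => r z.1 z.2)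
    {B : ℝ} (hB : ∀ x y, |r x y| ≤ B)
    (hr : ∀ ℓ s, ∫ z : (Fin k → S) × ({q : Fin k × Fin k // q.1 < q.2} → M),
      r (Function.update z.1 ℓ s) z.2
        ∂((Measure.pi fun _ => μ).prod (Measure.pi fun _ => Q)) = 0)
    {β' β : Fin k ↪ Fin n} (hβ : (β', β) ∉ overlappingPairs k n) :
    ∫ p : (Fin n → S) × ({q : Fin n × Fin n // q.1 < q.2} → M),
      r (fun i => p.1 (β' i)) (fun q => p.2 (pairIdx β' q)) *
        r (fun i => p.1 (β i)) (fun q => p.2 (pairIdx β q))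
        ∂((Measure.pi fun _ => μ).prod (Measure.pi fun _ => Q)) = 0 := by
  simp only [overlappingPairs, Finset.mem_filter, Finset.mem_univ, true_and, not_exists] at hβ
  obtain ⟨ℓ, hℓ⟩ : ∃ ℓ, ∀ m m', β m = β' m' → m = ℓ := by
    by_cases h : ∃ ℓ m', β ℓ = β' m'
    · obtain ⟨ℓ, m₀, h₀⟩ := h
      refine ⟨ℓ, fun m m' h => ?_⟩
      by_contra hne
      refine hβ m' m₀ m ℓ ⟨?_, h.symm, h₀.symm⟩
      rintro rfl
      exact hne (β.injective (h.trans h₀.symm))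
    · exact ⟨⟨0, by omega⟩, fun m m' h' => absurd ⟨m, m', h'⟩ h⟩
  refine integral_mul_block_eq_zero μ Q hrm hB ℓ (hr ℓ) β
    (F := fun x y => r (fun i => x (β' i)) (fun q => y (pairIdx β' q)))
    (measurable_block hrm β') (fun x y => hB _ _) fun x y z w => ?_
  congr 1
  · ext i
    exact resample_apply_of_notMem _ _ fun m hm h => hm (hℓ m i h)
  · ext q
    refine resample_apply_of_notMem _ _ fun q' _ h => q'.2.ne ?_
    rcases pairIdx_eq_imp h with ⟨h1, h2⟩ | ⟨h1, h2⟩ <;>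
      rw [hℓ _ _ h1, hℓ _ _ h2]

theorem integral_block_eq_zero (hk : 2 ≤ k) (μ : Measure S) [IsProbabilityMeasure μ]
    (Q : Measure M) [IsProbabilityMeasure Q]
    {r : (Fin k → S) → ({q : Fin k × Fin k // q.1 < q.2} → M) → ℝ}
    (hrm : Measurable fun z : (Fin k → S) × ({q : Fin k × Fin k // q.1 < q.2} → M) => r z.1 z.2)
    {B : ℝ} (hB : ∀ x y, |r x y| ≤ B)
    (hr : ∀ ℓ s, ∫ z : (Fin k → S) × ({q : Fin k × Fin k // q.1 < q.2} → M),
      r (Function.update z.1 ℓ s) z.2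
        ∂((Measure.pi fun _ => μ).prod (Measure.pi fun _ => Q)) = 0)
    (β : Fin k ↪ Fin n) :
    ∫ p : (Fin n → S) × ({q : Fin n × Fin n // q.1 < q.2} → M),
      r (fun i => p.1 (β i)) (fun q => p.2 (pairIdx β q))
        ∂((Measure.pi fun _ => μ).prod (Measure.pi fun _ => Q)) = 0 := by
  simpa using integral_mul_block_eq_zero μ Q hrm hB ⟨0, by omega⟩ (hr _) β
    (F := fun _ _ => 1) measurable_const (B' := 1) (by simp) (by simp)

theorem integral_sum_block_sq_le (hk : 2 ≤ k) (μ : Measure S) [IsProbabilityMeasure μ]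
    (Q : Measure M) [IsProbabilityMeasure Q]
    {r : (Fin k → S) → ({q : Fin k × Fin k // q.1 < q.2} → M) → ℝ}
    (hrm : Measurable fun z : (Fin k → S) × ({q : Fin k × Fin k // q.1 < q.2} → M) => r z.1 z.2)
    {B : ℝ} (hB : ∀ x y, |r x y| ≤ B)
    (hr : ∀ ℓ s, ∫ z : (Fin k → S) × ({q : Fin k × Fin k // q.1 < q.2} → M),
      r (Function.update z.1 ℓ s) z.2
        ∂((Measure.pi fun _ => μ).prod (Measure.pi fun _ => Q)) = 0) :
    ∫ p : (Fin n → S) × ({q : Fin n × Fin n // q.1 < q.2} → M),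
      (∑ β : Fin k ↪ Fin n, r (fun i => p.1 (β i)) (fun q => p.2 (pairIdx β q))) ^ 2
        ∂((Measure.pi fun _ => μ).prod (Measure.pi fun _ => Q)) ≤
      k ^ 4 * n ^ (2 * k - 2) * B ^ 2 := by
  have hbd : ∀ x y x' y', |r x y * r x' y'| ≤ B ^ 2 := fun x y x' y' => by
    rw [abs_mul, sq]
    exact mul_le_mul (hB _ _) (hB _ _) (abs_nonneg _) ((abs_nonneg _).trans (hB x y))
  have hi : ∀ t : (Fin k ↪ Fin n) × (Fin k ↪ Fin n), Integrable
      (fun p : (Fin n → S) × ({q : Fin n × Fin n // q.1 < q.2} → M) =>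
        r (fun i => p.1 (t.1 i)) (fun q => p.2 (pairIdx t.1 q)) *
        r (fun i => p.1 (t.2 i)) (fun q => p.2 (pairIdx t.2 q)))
      ((Measure.pi fun _ => μ).prod (Measure.pi fun _ => Q)) := fun t =>
    integrable_of_measurable_bounded ((measurable_block hrm t.1).mul (measurable_block hrm t.2))
      fun p => hbd _ _ _ _
  simp only [sq (∑ _, _), Finset.sum_mul_sum, ← Finset.sum_product', Finset.univ_product_univ]
  rw [integral_finsetSum _ fun t _ => hi t,
    ← Finset.sum_subset (Finset.subset_univ (overlappingPairs k n))
      fun t _ ht => integral_block_mul_block_eq_zero hk μ Q hrm hB hr ht]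
  refine (Finset.sum_le_card_nsmul _ _ (B ^ 2) fun t _ => ?_).trans ?_
  · refine (le_abs_self _).trans ?_
    rw [← Real.norm_eq_abs]
    exact (norm_integral_le_of_norm_le_const (C := B ^ 2) (ae_of_all _ fun z => hbd _ _ _ _)).trans
      (by simp)
  · rw [nsmul_eq_mul]
    gcongr
    exact_mod_cast card_overlappingPairs_le hk

end SecondMoments

section Normalization

/-- Normalizing two square-integrable random variables by their `L²` norms does not increase
their distance by more than a factor of two, relative to one of the two norms. -/
theorem integral_div_sub_div_sq_le {α : Type*} [MeasurableSpace α] {ρ : Measure α} {A H : α → ℝ}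
    (hA : MemLp A 2 ρ) (hH : MemLp H 2 ρ) {s a : ℝ} (hs : 0 ≤ s) (ha : 0 < a)
    (hAs : ∫ x, A x ^ 2 ∂ρ = s ^ 2) (hHa : ∫ x, H x ^ 2 ∂ρ = a ^ 2) :
    ∫ x, (A x / s - H x / a) ^ 2 ∂ρ ≤ 4 * (∫ x, (A x - H x) ^ 2 ∂ρ) / a ^ 2 := by
  have expand : ∀ u w : ℝ, ∫ x, (A x * u - H x * w) ^ 2 ∂ρ =
      s ^ 2 * u ^ 2 - 2 * u * w * (∫ x, A x * H x ∂ρ) + a ^ 2 * w ^ 2 := fun u w => by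
    have e : ∀ x, (A x * u - H x * w) ^ 2 =
        u ^ 2 * A x ^ 2 - 2 * u * w * (A x * H x) + w ^ 2 * H x ^ 2 := fun x => by ring
    have i1 := hA.integrable_sq.const_mul (u ^ 2)
    have i2 := (hA.integrable_mul hH).const_mul (2 * u * w)
    have i3 := hH.integrable_sq.const_mul (w ^ 2)
    simp only [Pi.mul_apply] at i2
    have i12 : Integrable (fun x => u ^ 2 * A x ^ 2 - 2 * u * w * (A x * H x)) ρ := i1.sub i2
    simp only [e]
    rw [integral_add i12 i3, integral_sub i1 i2, integral_const_mul, integral_const_mul,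
      integral_const_mul, hAs, hHa]
    ring
  set c := ∫ x, A x * H x ∂ρ
  have hcs : |c| ≤ a * s := by
    refine abs_le_of_sq_le_sq ?_ (by positivity)
    have h : 0 ≤ ∫ x, (A x * a ^ 2 - H x * c) ^ 2 ∂ρ := integral_nonneg fun x => sq_nonneg _
    rw [expand] at h
    have : 0 ≤ a ^ 2 * ((a * s) ^ 2 - c ^ 2) := by linarith
    have := nonneg_of_mul_nonneg_right this (by positivity)
    linarith
  have h1 := expand s⁻¹ a⁻¹
  have h2 := expand 1 1
  simp only [mul_one, ← div_eq_mul_inv] at h1 h2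
  rw [h1, h2, le_div_iff₀ (by positivity)]
  obtain ⟨hc1, hc2⟩ := abs_le.1 hcs
  rcases hs.eq_or_lt with rfl | hs
  · have : c = 0 := by linarith
    have e1 : a ^ 2 * a⁻¹ ^ 2 = 1 := by field_simp
    rw [this, e1]
    norm_num
    linarith [sq_nonneg a]
  · have e : (s ^ 2 * s⁻¹ ^ 2 - 2 / s / a * c + a ^ 2 * a⁻¹ ^ 2) * a ^ 2 =
        (2 * a ^ 2 * s - 2 * c * a) / s := by field_simp; ring
    rw [e, div_le_iff₀ hs]
    rcases le_total 0 (a - 4 * s) with h | h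
    · nlinarith [mul_nonneg h (by linarith : (0 : ℝ) ≤ c + a * s), mul_pos hs ha,
        mul_pos hs (mul_pos hs hs), mul_pos ha (mul_pos hs hs)]
    · nlinarith [mul_nonneg (by linarith : (0 : ℝ) ≤ 4 * s - a) (by linarith : (0 : ℝ) ≤ a * s - c),
        mul_nonneg hs.le (sq_nonneg (s - a))]

/-- Comparison of two smoothed distribution functions through the `L²` distance. -/
theorem abs_integral_step_sub_integral_step_le {α : Type*} [MeasurableSpace α] {ρ : Measure α}
    [IsProbabilityMeasure ρ] {T W : α → ℝ} (hT : MemLp T 2 ρ) (hW : MemLp W 2 ρ)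
    {φ : ℝ → ℝ} (hc : Continuous φ) (hb : ∀ t, |φ t| ≤ 1) {K : ℝ} (hK : 0 ≤ K)
    (hlip : ∀ s t, |φ s - φ t| ≤ K * |s - t|) {e D : ℝ} (he : 0 < e)
    (hD : ∫ x, (T x - W x) ^ 2 ∂ρ ≤ D) (y : ℝ) :
    |∫ x, φ ((T x - y) / e) ∂ρ - ∫ x, φ ((W x - y) / e) ∂ρ| ≤ K * (e + D / e ^ 3) := by
  have hi : ∀ {Z : α → ℝ}, MemLp Z 2 ρ → Integrable (fun x => φ ((Z x - y) / e)) ρ := fun hZ =>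
    Integrable.of_bound (hc.measurable.comp_aemeasurable
      ((hZ.1.aemeasurable.sub_const y).div_const e)).aestronglyMeasurable 1
      (ae_of_all _ fun x => hb _)
  have hsq : Integrable (fun x => (T x - W x) ^ 2) ρ := (hT.sub hW).integrable_sq
  rw [← integral_sub (hi hT) (hi hW)]
  refine (abs_integral_le_integral_abs).trans ?_
  have hpt : ∀ x, |φ ((T x - y) / e) - φ ((W x - y) / e)| ≤
      K * (e + (T x - W x) ^ 2 / e ^ 3) := fun x => by
    refine (hlip _ _).trans (mul_le_mul_of_nonneg_left ?_ hK)
    rw [← sub_div, sub_sub_sub_cancel_right, abs_div, abs_of_pos he]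
    have : e + (T x - W x) ^ 2 / e ^ 3 = (e ^ 4 + (T x - W x) ^ 2) / e ^ 3 := by
      field_simp
    rw [this, div_le_div_iff₀ he (by positivity), ← sq_abs (T x - W x)]
    nlinarith [mul_nonneg he.le (sq_nonneg (|T x - W x| - e ^ 2)), abs_nonneg (T x - W x),
      mul_nonneg (pow_pos he 3).le (abs_nonneg (T x - W x))]
  refine (integral_mono ((hi hT).sub (hi hW)).abs
    (((integrable_const e).add (hsq.div_const (e ^ 3))).const_mul K) hpt).trans ?_
  simp only [Pi.add_apply]
  rw [integral_const_mul, integral_add (integrable_const e) (hsq.div_const _), integral_div]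
  simp only [integral_const, probReal_univ, one_smul]
  gcongr

end Normalization

section Projection

variable {S M : Type*} [MeasurableSpace S] [MeasurableSpace M] {k n : ℕ}

/-- The sum over all embeddings of a kernel of point and pair variables. -/
noncomputable def embeddingSum (n : ℕ)
    (f : (Fin k → S) → ({q : Fin k × Fin k // q.1 < q.2} → M) → ℝ)
    (p : (Fin n → S) × ({q : Fin n × Fin n // q.1 < q.2} → M)) : ℝ :=
  ∑ β : Fin k ↪ Fin n, f (fun i => p.1 (β i)) (fun q => p.2 (pairIdx β q))

theorem measurable_embeddingSum
    {f : (Fin k → S) → ({q : Fin k × Fin k // q.1 < q.2} → M) → ℝ}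
    (hf : Measurable fun z : (Fin k → S) × ({q : Fin k × Fin k // q.1 < q.2} → M) => f z.1 z.2) :
    Measurable (embeddingSum n f) :=
  Finset.measurable_sum _ fun β _ => measurable_block hf β

theorem memLp_embeddingSum (μ : Measure S) [IsProbabilityMeasure μ]
    (Q : Measure M) [IsProbabilityMeasure Q]
    {f : (Fin k → S) → ({q : Fin k × Fin k // q.1 < q.2} → M) → ℝ}
    (hf : Measurable fun z : (Fin k → S) × ({q : Fin k × Fin k // q.1 < q.2} → M) => f z.1 z.2)
    {C₀ : ℝ} (hC₀ : ∀ x y, |f x y| ≤ C₀) :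
    MemLp (embeddingSum n f) 2 ((Measure.pi fun _ => μ).prod (Measure.pi fun _ => Q)) :=
  memLp_finsetSum _ fun β _ => MemLp.of_bound (measurable_block hf β).aestronglyMeasurable C₀
    (ae_of_all _ fun _ => hC₀ _ _)

/-- The centered sum of the one-coordinate projections of a kernel. -/
noncomputable def centeredProj (f : (Fin k → S) → ({q : Fin k × Fin k // q.1 < q.2} → M) → ℝ)
    (μ : Measure S) (Q : Measure M) (s : S) : ℝ :=
  ∑ ℓ, (fProj f μ Q ℓ s - kernelMean f μ Q)

/-- The linear part of the Hoeffding decomposition. -/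
theorem embeddingSum_eq (μ : Measure S) (Q : Measure M)
    (f : (Fin k → S) → ({q : Fin k × Fin k // q.1 < q.2} → M) → ℝ)
    (p : (Fin n → S) × ({q : Fin n × Fin n // q.1 < q.2} → M)) :
    embeddingSum n f p = n.descFactorial k * kernelMean f μ Q +
      (n.descFactorial k / n) * (∑ i, centeredProj f μ Q (p.1 i)) +
        embeddingSum n (kernelRem f μ Q) p := by
  have h1 : ∑ β : Fin k ↪ Fin n, ∑ ℓ, (fProj f μ Q ℓ (p.1 (β ℓ)) - kernelMean f μ Q) =
      (n.descFactorial k / n) * (∑ i, centeredProj f μ Q (p.1 i)) := by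
    simp only [centeredProj]
    rw [Finset.sum_comm, Finset.sum_comm (s := (Finset.univ : Finset (Fin n))), Finset.mul_sum]
    refine Finset.sum_congr rfl fun ℓ _ => ?_
    rw [← Finset.sum_fiberwise (s := (Finset.univ : Finset (Fin k ↪ Fin n)))
      (g := fun β => β ℓ), Finset.mul_sum]
    refine Finset.sum_congr rfl fun i _ => ?_
    have hn : (n : ℝ) ≠ 0 := by
      rintro h
      rw [Nat.cast_eq_zero] at h
      exact absurd i.2 (by omega)
    have hcard : (n.descFactorial k : ℝ) / n = #{β : Fin k ↪ Fin n | β ℓ = i} := by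
      rw [div_eq_iff hn, mul_comm, ← card_mul_card_embedding_apply_eq ℓ i]
      push_cast
      rfl
    rw [hcard, ← nsmul_eq_mul]
    refine Finset.sum_eq_card_nsmul fun β hβ => ?_
    rw [(Finset.mem_filter.1 hβ).2]
  rw [← h1]
  simp only [embeddingSum, kernelRem, Finset.sum_sub_distrib]
  simp [Fintype.card_embedding_eq]

end Projection

section LinearPart

variable {S M : Type*} [MeasurableSpace S] [MeasurableSpace M] {k n : ℕ}

theorem measurable_centeredProj (μ : Measure S) [IsProbabilityMeasure μ]
    (Q : Measure M) [IsProbabilityMeasure Q]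
    {f : (Fin k → S) → ({q : Fin k × Fin k // q.1 < q.2} → M) → ℝ}
    (hf : Measurable fun z : (Fin k → S) × ({q : Fin k × Fin k // q.1 < q.2} → M) => f z.1 z.2) :
    Measurable (centeredProj f μ Q) :=
  Finset.measurable_sum _ fun ℓ _ => (fProj_measurable μ Q hf ℓ).sub_const _

theorem memLp_centeredProj (μ : Measure S) [IsProbabilityMeasure μ]
    (Q : Measure M) [IsProbabilityMeasure Q]
    {f : (Fin k → S) → ({q : Fin k × Fin k // q.1 < q.2} → M) → ℝ}
    (hf : Measurable fun z : (Fin k → S) × ({q : Fin k × Fin k // q.1 < q.2} → M) => f z.1 z.2)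
    {C₀ : ℝ} (hC₀ : ∀ x y, |f x y| ≤ C₀) (p : ENNReal) : MemLp (centeredProj f μ Q) p μ :=
  memLp_finsetSum _ fun ℓ _ => (MemLp.of_bound (fProj_measurable μ Q hf ℓ).aestronglyMeasurable C₀
    (ae_of_all _ fun s => abs_fProj_le μ Q hC₀ ℓ s)).sub (memLp_const _)

theorem integral_centeredProj (μ : Measure S) [IsProbabilityMeasure μ]
    (Q : Measure M) [IsProbabilityMeasure Q]
    {f : (Fin k → S) → ({q : Fin k × Fin k // q.1 < q.2} → M) → ℝ}
    (hf : Measurable fun z : (Fin k → S) × ({q : Fin k × Fin k // q.1 < q.2} → M) => f z.1 z.2)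
    {C₀ : ℝ} (hC₀ : ∀ x y, |f x y| ≤ C₀) : ∫ s, centeredProj f μ Q s ∂μ = 0 := by
  have hi : ∀ ℓ, Integrable (fProj f μ Q ℓ) μ := fun ℓ =>
    integrable_of_measurable_bounded (fProj_measurable μ Q hf ℓ) (abs_fProj_le μ Q hC₀ ℓ)
  have hi' : ∀ ℓ, Integrable (fun s => fProj f μ Q ℓ s - kernelMean f μ Q) μ := fun ℓ =>
    (hi ℓ).sub (integrable_const _)
  simp only [centeredProj]
  rw [integral_finsetSum _ fun ℓ _ => hi' ℓ]
  refine Finset.sum_eq_zero fun ℓ _ => ?_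
  rw [integral_sub (hi ℓ) (integrable_const _), integral_fProj μ Q hf hC₀]
  simp

theorem integral_centeredProj_sq (μ : Measure S) [IsProbabilityMeasure μ]
    (Q : Measure M) [IsProbabilityMeasure Q]
    {f : (Fin k → S) → ({q : Fin k × Fin k // q.1 < q.2} → M) → ℝ}
    (hf : Measurable fun z : (Fin k → S) × ({q : Fin k × Fin k // q.1 < q.2} → M) => f z.1 z.2)
    {C₀ : ℝ} (hC₀ : ∀ x y, |f x y| ≤ C₀) :
    ∫ s, centeredProj f μ Q s ^ 2 ∂μ = variance (fun s => ∑ ℓ, fProj f μ Q ℓ s) μ := by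
  have hi : ∀ ℓ, Integrable (fProj f μ Q ℓ) μ := fun ℓ =>
    integrable_of_measurable_bounded (fProj_measurable μ Q hf ℓ) (abs_fProj_le μ Q hC₀ ℓ)
  rw [variance_eq_integral
    (Finset.measurable_sum _ fun ℓ _ => fProj_measurable μ Q hf ℓ).aemeasurable,
    integral_finsetSum _ fun ℓ _ => hi ℓ]
  simp only [integral_fProj μ Q hf hC₀, ← Finset.sum_sub_distrib]
  rfl

theorem integral_sum_eq_zero_pi (μ : Measure S) [IsProbabilityMeasure μ] {g : S → ℝ}
    (hg : Integrable g μ) (h0 : ∫ s, g s ∂μ = 0) :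
    ∫ x : Fin n → S, ∑ i, g (x i) ∂(Measure.pi fun _ => μ) = 0 := by
  have hi : ∀ i, Integrable (fun x : Fin n → S => g (x i)) (Measure.pi fun _ => μ) := fun i =>
    (measurePreserving_eval (fun _ : Fin n => μ) i).integrable_comp_of_integrable hg
  rw [integral_finsetSum _ fun i _ => hi i]
  refine Finset.sum_eq_zero fun i _ => ?_
  rw [integral_comp_eval (μ := fun _ : Fin n => μ) (i := i) hg.1, h0]

theorem integral_sum_sq_pi (μ : Measure S) [IsProbabilityMeasure μ] {g : S → ℝ}
    (hg : MemLp g 2 μ) (h0 : ∫ s, g s ∂μ = 0) :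
    ∫ x : Fin n → S, (∑ i, g (x i)) ^ 2 ∂(Measure.pi fun _ => μ) = n * ∫ s, g s ^ 2 ∂μ := by
  have h := variance_sum_pi (μ := fun _ : Fin n => μ) (X := fun _ => g) fun _ => hg
  have hfun : (∑ i : Fin n, fun x : Fin n → S => g (x i)) = fun x => ∑ i, g (x i) := by
    ext x; simp
  have hm : MemLp (fun x : Fin n → S => ∑ i, g (x i)) 2 (Measure.pi fun _ => μ) :=
    memLp_finsetSum _ fun i _ =>
      hg.comp_measurePreserving (measurePreserving_eval (fun _ : Fin n => μ) i)
  rw [hfun, variance_of_integral_eq_zero hm.1.aemeasurable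
    (integral_sum_eq_zero_pi μ (hg.integrable one_le_two) h0),
    variance_of_integral_eq_zero hg.1.aemeasurable h0] at h
  simpa using h

end LinearPart

section Distance

variable {S M : Type*} [MeasurableSpace S] [MeasurableSpace M] {k n : ℕ}

theorem pow_div_two_pow_le_descFactorial (hn : 4 * (k - 1) ≤ n) :
    (n : ℝ) ^ k / 2 ^ k ≤ n.descFactorial k := by
  have h1 : ((n + 1 - k : ℕ) : ℝ) ^ k ≤ n.descFactorial k := by
    exact_mod_cast Nat.pow_sub_le_descFactorial n k
  rw [← div_pow]
  refine (pow_le_pow_left₀ (by positivity) ?_ k).trans h1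
  rw [div_le_iff₀ two_pos]
  exact_mod_cast (by omega : n ≤ (n + 1 - k) * 2)

/-- The normalized sum is close in `L²` to its normalized linear part. -/
theorem integral_normalized_sub_linear_sq_le (hk : 2 ≤ k) (hn : 4 * (k - 1) ≤ n)
    (μ : Measure S) [IsProbabilityMeasure μ] (Q : Measure M) [IsProbabilityMeasure Q]
    {f : (Fin k → S) → ({q : Fin k × Fin k // q.1 < q.2} → M) → ℝ}
    (hf : Measurable fun z : (Fin k → S) × ({q : Fin k × Fin k // q.1 < q.2} → M) => f z.1 z.2)
    {C₀ : ℝ} (hC₀ : ∀ x y, |f x y| ≤ C₀) {v : ℝ} (hvpos : 0 < v)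
    (hv : ∫ s, centeredProj f μ Q s ^ 2 ∂μ = v)
    {ρ : Measure ((Fin n → S) × ({q : Fin n × Fin n // q.1 < q.2} → M))}
    (hρ : ρ = (Measure.pi fun _ => μ).prod (Measure.pi fun _ => Q)) :
    ∫ p, ((embeddingSum n f p - ∫ p', embeddingSum n f p' ∂ρ) / √(variance (embeddingSum n f) ρ) -
      (∑ i, centeredProj f μ Q (p.1 i)) / (√v * √n)) ^ 2 ∂ρ ≤
      4 ^ (k + 1) * k ^ 4 * (2 * (k + 1) * C₀) ^ 2 / v / n := by
  have hn0 : 0 < n := by omega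
  have hnpos : (0 : ℝ) < n := by exact_mod_cast hn0
  have hρp : IsProbabilityMeasure ρ := hρ ▸ inferInstance
  set g := centeredProj f μ Q with hg
  have hgL := memLp_centeredProj μ Q hf hC₀
  have hg0 := integral_centeredProj μ Q hf hC₀
  set N : ℝ := n.descFactorial k / n with hN
  set L : (Fin n → S) × ({q : Fin n × Fin n // q.1 < q.2} → M) → ℝ := fun p => ∑ i, g (p.1 i)
    with hL
  have hmp : MeasurePreserving (Prod.fst : (Fin n → S) × ({q : Fin n × Fin n // q.1 < q.2} → M) →
      (Fin n → S)) ρ (Measure.pi fun _ => μ) := hρ ▸ measurePreserving_fst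
  have hLL : MemLp L 2 ρ := memLp_finsetSum _ fun i _ =>
    (hgL 2).comp_measurePreserving ((measurePreserving_eval (fun _ : Fin n => μ) i).comp hmp)
  have hL0 : ∫ p, L p ∂ρ = 0 := by
    rw [hρ, hL, integral_fun_fst (fun x : Fin n → S => ∑ i, g (x i)),
      integral_sum_eq_zero_pi μ ((hgL 1).integrable le_rfl) hg0, smul_zero]
  have hL2 : ∫ p, L p ^ 2 ∂ρ = n * v := by
    rw [hρ, hL, integral_fun_fst (fun x : Fin n → S => (∑ i, g (x i)) ^ 2),
      integral_sum_sq_pi μ (hgL 2) hg0, hv]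
    simp
  have hrm := kernelRem_measurable μ Q hf
  have hrb := abs_kernelRem_le μ Q hC₀
  have hr := integral_kernelRem_update μ Q hf hC₀
  have hUL : MemLp (embeddingSum n f) 2 ρ := hρ ▸ memLp_embeddingSum μ Q hf hC₀
  have hRL : MemLp (embeddingSum n (kernelRem f μ Q)) 2 ρ :=
    hρ ▸ memLp_embeddingSum μ Q hrm hrb
  have hR0 : ∫ p, embeddingSum n (kernelRem f μ Q) p ∂ρ = 0 := by
    rw [hρ]
    simp only [embeddingSum]
    rw [integral_finsetSum _ fun β _ => integrable_of_measurable_bounded (measurable_block hrm β)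
      fun p => hrb _ _]
    exact Finset.sum_eq_zero fun β _ => integral_block_eq_zero hk μ Q hrm hrb hr β
  have hU0 : ∫ p, embeddingSum n f p ∂ρ = n.descFactorial k * kernelMean f μ Q := by
    simp only [embeddingSum_eq μ Q f]
    have i1 : Integrable (fun p => N * L p) ρ := (hLL.integrable one_le_two).const_mul N
    have i2 : Integrable (fun p => n.descFactorial k * kernelMean f μ Q + N * L p) ρ :=
      (integrable_const _).add i1
    rw [integral_add i2 (hRL.integrable one_le_two), integral_add (integrable_const _) i1, hR0,
      integral_const_mul N L, hL0]
    simp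
  have hNge : (n : ℝ) ^ (k - 1) / 2 ^ k ≤ N := by
    rw [hN, le_div_iff₀ hnpos, div_mul_eq_mul_div, ← pow_succ, Nat.sub_add_cancel (by omega)]
    exact pow_div_two_pow_le_descFactorial hn
  have hNpos : 0 < N := lt_of_lt_of_le (by positivity) hNge
  have ha : 0 < N * (√v * √n) := by positivity
  have key := integral_div_sub_div_sq_le (ρ := ρ)
    (A := fun p => embeddingSum n f p - ∫ p', embeddingSum n f p' ∂ρ) (H := fun p => N * L p)
    (hUL.sub (memLp_const _)) (hLL.const_mul N)
    (Real.sqrt_nonneg (variance (embeddingSum n f) ρ)) ha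
    (by rw [Real.sq_sqrt (variance_nonneg _ _), variance_eq_integral hUL.1.aemeasurable])
    (by simp only [mul_pow]
        rw [integral_const_mul, hL2, Real.sq_sqrt hvpos.le, Real.sq_sqrt hnpos.le]; ring)
  have hH : ∀ p, N * L p / (N * (√v * √n)) = L p / (√v * √n) := fun p =>
    mul_div_mul_left _ _ hNpos.ne'
  have hR : ∀ p, embeddingSum n f p - (∫ p', embeddingSum n f p' ∂ρ) - N * L p =
      embeddingSum n (kernelRem f μ Q) p := fun p => by
    rw [hU0, embeddingSum_eq μ Q f p]; ring
  simp only [hH, hR] at key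
  refine key.trans ?_
  have hR2 : ∫ p, embeddingSum n (kernelRem f μ Q) p ^ 2 ∂ρ ≤
      k ^ 4 * n ^ (2 * k - 2) * (2 * (k + 1) * C₀) ^ 2 := by
    rw [hρ]
    exact integral_sum_block_sq_le hk μ Q hrm hrb hr
  have hden : (n : ℝ) ^ (2 * k - 2) * (v * n) / 4 ^ k ≤ (N * (√v * √n)) ^ 2 := by
    rw [mul_pow, mul_pow, Real.sq_sqrt hvpos.le, Real.sq_sqrt hnpos.le, mul_div_right_comm]
    have h := pow_le_pow_left₀ (by positivity) hNge 2
    have e : (n : ℝ) ^ (2 * k - 2) / 4 ^ k = ((n : ℝ) ^ (k - 1) / 2 ^ k) ^ 2 := by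
      rw [div_pow, ← pow_mul, ← pow_mul, mul_comm k 2, pow_mul 2 2 k, Nat.sub_mul,
        mul_comm k 2]
      norm_num
    rw [e]
    gcongr
  refine (div_le_div₀ (by positivity) (mul_le_mul_of_nonneg_left hR2 zero_le_four)
    (by positivity) hden).trans (le_of_eq ?_)
  field_simp
  ring

end Distance

section Rate

variable {S M : Type*} [MeasurableSpace S] [MeasurableSpace M] {k n : ℕ}

theorem one_le_rpow_neg_pow_mul_sqrt (hk : 2 ≤ k) (hn : 1 ≤ n) :
    1 ≤ ((n : ℝ) ^ (-((1 : ℝ) / (2 + 4 * (k : ℝ))))) ^ 4 * √n := by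
  have hn1 : (1 : ℝ) ≤ n := by exact_mod_cast hn
  have hk2 : (2 : ℝ) ≤ k := by exact_mod_cast hk
  rw [← Real.rpow_mul_natCast (by positivity), Real.sqrt_eq_rpow,
    ← Real.rpow_add (by positivity)]
  refine Real.one_le_rpow hn1 ?_
  have : (1 : ℝ) / (2 + 4 * k) ≤ 1 / 10 := one_div_le_one_div_of_le (by norm_num) (by linarith)
  push_cast
  linarith

/-- The Kolmogorov bound for sums over embeddings of a kernel on a product space. -/
theorem exists_kolmogorov_bound_embeddingSum (hk : 2 ≤ k)
    (μ : Measure S) [IsProbabilityMeasure μ] (Q : Measure M) [IsProbabilityMeasure Q]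
    {f : (Fin k → S) → ({q : Fin k × Fin k // q.1 < q.2} → M) → ℝ}
    (hf : Measurable fun z : (Fin k → S) × ({q : Fin k × Fin k // q.1 < q.2} → M) => f z.1 z.2)
    {C₀ : ℝ} (hC₀ : ∀ x y, |f x y| ≤ C₀)
    (hA : 0 < variance (fun x => ∑ ℓ : Fin k, fProj f μ Q ℓ x) μ) :
    ∃ C > (0 : ℝ), ∀ n, 4 * (k - 1) ≤ n →
      ∀ ρ : Measure ((Fin n → S) × ({q : Fin n × Fin n // q.1 < q.2} → M)),
      ρ = (Measure.pi fun _ => μ).prod (Measure.pi fun _ => Q) → ∀ x : ℝ,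
      |(ρ {p | (embeddingSum n f p - ∫ p', embeddingSum n f p' ∂ρ) /
        √(variance (embeddingSum n f) ρ) ≤ x}).toReal - gaussCdf x|
        ≤ C / (n : ℝ) ^ ((1 : ℝ) / (2 + 4 * (k : ℝ))) := by
  obtain ⟨φ, K, hK, hc, h0, h1, hl, hr, hlip, hT⟩ := exists_smooth_step
  have hb : ∀ t, |φ t| ≤ 1 := fun t => abs_le.2 ⟨by linarith [h0 t], h1 t⟩
  set v : NNReal := ⟨variance (fun x => ∑ ℓ : Fin k, fProj f μ Q ℓ x) μ, hA.le⟩ with hvdef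
  have hvpos : 0 < v := hA
  have hv : ∫ s, centeredProj f μ Q s ^ 2 ∂μ = v := integral_centeredProj_sq μ Q hf hC₀
  set C₁ : ℝ := 4 ^ (k + 1) * k ^ 4 * (2 * (k + 1) * C₀) ^ 2 / v with hC₁
  set C₂ : ℝ := (K * ∫ s, |centeredProj f μ Q s| ^ 3 ∂μ + K * ∫ t, |t| ^ 3 ∂(gaussianReal 0 v)) /
    √v ^ 3 with hC₂
  have hC₁0 : 0 ≤ C₁ := by positivity
  have hC₂0 : 0 ≤ C₂ := by
    have i1 : 0 ≤ ∫ s, |centeredProj f μ Q s| ^ 3 ∂μ := integral_nonneg fun s => by positivity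
    have i2 : 0 ≤ ∫ t, |t| ^ 3 ∂(gaussianReal 0 v) := integral_nonneg fun s => by positivity
    positivity
  refine ⟨1 + (K * (1 + C₁) + C₂), by positivity, fun n hn ρ hρ x => ?_⟩
  have hn0 : 0 < n := by omega
  have hnpos : (0 : ℝ) < n := by exact_mod_cast hn0
  have hρp : IsProbabilityMeasure ρ := hρ ▸ inferInstance
  set e : ℝ := (n : ℝ) ^ (-((1 : ℝ) / (2 + 4 * (k : ℝ)))) with he
  have hepos : 0 < e := Real.rpow_pos_of_pos hnpos _
  have hrate : 1 ≤ e ^ 4 * √n := one_le_rpow_neg_pow_mul_sqrt hk hn0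
  have hsn : √(n : ℝ) ≤ n := by
    rw [Real.sqrt_le_left hnpos.le]
    exact le_self_pow₀ (by exact_mod_cast hn0) two_ne_zero
  have hUL : MemLp (embeddingSum n f) 2 ρ := hρ ▸ memLp_embeddingSum μ Q hf hC₀
  set T : (Fin n → S) × ({q : Fin n × Fin n // q.1 < q.2} → M) → ℝ := fun p =>
    (embeddingSum n f p - ∫ p', embeddingSum n f p' ∂ρ) / √(variance (embeddingSum n f) ρ)
    with hTdef
  have hTL : MemLp T 2 ρ := by
    simp only [hTdef, div_eq_mul_inv]
    exact (hUL.sub (memLp_const _)).mul_const _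
  set W : (Fin n → S) × ({q : Fin n × Fin n // q.1 < q.2} → M) → ℝ := fun p =>
    (∑ i, centeredProj f μ Q (p.1 i)) / (√v * √n) with hWdef
  have hmp : MeasurePreserving (Prod.fst : (Fin n → S) × ({q : Fin n × Fin n // q.1 < q.2} → M) →
      (Fin n → S)) ρ (Measure.pi fun _ => μ) := hρ ▸ measurePreserving_fst
  have hWL : MemLp W 2 ρ := by
    simp only [hWdef, div_eq_mul_inv]
    exact (memLp_finsetSum _ fun i _ => (memLp_centeredProj μ Q hf hC₀ 2).comp_measurePreserving
      ((measurePreserving_eval (fun _ : Fin n => μ) i).comp hmp)).mul_const _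
  have key : ∀ y, |∫ p, φ ((T p - y) / e) ∂ρ - ∫ t, φ ((t - y) / e) ∂(gaussianReal 0 1)| ≤
      (K * (1 + C₁) + C₂) * e := fun y => by
    have k1 := abs_integral_step_sub_integral_step_le hTL hWL hc hb hK.le hlip hepos
      (integral_normalized_sub_linear_sq_le hk hn μ Q hf hC₀ (NNReal.coe_pos.2 hvpos) hv hρ) y
    have k2 := abs_integral_step_sum_sub_gaussian_le μ (measurable_centeredProj μ Q hf)
      (memLp_centeredProj μ Q hf hC₀ 3) (integral_centeredProj μ Q hf hC₀) hv hvpos hc hb hT hn0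
      hepos y
    have k3 : ∫ p, φ ((W p - y) / e) ∂ρ = ∫ x : Fin n → S,
        φ (((∑ i, centeredProj f μ Q (x i)) / (√v * √n) - y) / e) ∂(Measure.pi fun _ => μ) := by
      rw [hρ, hWdef, integral_fun_fst (fun x : Fin n → S =>
        φ (((∑ i, centeredProj f μ Q (x i)) / (√v * √n) - y) / e))]
      simp
    rw [← k3, ← hC₂] at k2
    rw [← hC₁] at k1
    have b1 : C₁ / n / e ^ 3 ≤ C₁ * e := by
      rw [div_div, div_le_iff₀ (by positivity), mul_assoc]
      refine le_mul_of_one_le_right hC₁0 (hrate.trans ?_)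
      calc e ^ 4 * √n ≤ e ^ 4 * n := by gcongr
        _ = e * (n * e ^ 3) := by ring
    have b2 : C₂ / (e ^ 3 * √n) ≤ C₂ * e := by
      rw [div_le_iff₀ (by positivity), mul_assoc]
      exact le_mul_of_one_le_right hC₂0 (hrate.trans_eq (by ring))
    calc _ ≤ K * (e + C₁ / n / e ^ 3) + C₂ / (e ^ 3 * √n) :=
          (abs_sub_le _ _ _).trans (add_le_add k1 k2)
      _ ≤ K * (e + C₁ * e) + C₂ * e := by gcongr
      _ = _ := by ring
  refine (abs_cdf_sub_gaussCdf_le ρ hTL.1.aemeasurable hc h0 h1 hl hr hepos key x).trans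
    (le_of_eq ?_)
  rw [he, Real.rpow_neg hnpos.le]
  ring

end Rate

/-- Kolmogorov bound for the normalized generalized U-statistic: under Assumption 1, there
is `C(f,k) > 0` such that for all `n ≥ 4(k−1)`,
`sup_x |P(S̄_{n,k}(f) ≤ x) − Φ(x)| ≤ C(f,k) n^{−1/(2+4k)}`. -/
theorem kolmogorov_bound_genUbar {S M : Type*} [MeasurableSpace S] [MeasurableSpace M]
    {k : ℕ} (hk : 2 ≤ k)
    (μ : Measure S) [IsProbabilityMeasure μ] (hμ : ∀ x, μ {x} = 0)
    (Q : Measure M) [IsProbabilityMeasure Q]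
    (Ω : ℕ → Type) [∀ n, MeasurableSpace (Ω n)]
    (P : ∀ n, Measure (Ω n)) [∀ n, IsProbabilityMeasure (P n)]
    (X : ∀ n, Fin n → Ω n → S) (Y : ∀ n, Fin n → Fin n → Ω n → M)
    (hYsym : ∀ n a b, Y n a b = Y n b a)
    (hlaw : ∀ n, Measure.map (fun ω => ((fun i => X n i ω),
        (fun q : {q : Fin n × Fin n // q.1 < q.2} => Y n q.1.1 q.1.2 ω))) (P n)
      = (Measure.pi fun _ => μ).prod (Measure.pi fun _ => Q))
    (f : (Fin k → S) → ({q : Fin k × Fin k // q.1 < q.2} → M) → ℝ)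
    (hf : Measurable fun z : (Fin k → S) × ({q : Fin k × Fin k // q.1 < q.2} → M) =>
      f z.1 z.2)
    (C₀ : ℝ) (hC₀ : ∀ x y, |f x y| ≤ C₀)
    (hA : 0 < variance (fun x => ∑ ℓ : Fin k, fProj f μ Q ℓ x) μ) :
    ∃ C > (0 : ℝ), ∀ n, 4 * (k - 1) ≤ n → ∀ x : ℝ,
      |((P n) {ω | genUbar (P n) f (X n) (Y n) ω ≤ x}).toReal - gaussCdf x|
        ≤ C / (n : ℝ) ^ ((1 : ℝ) / (2 + 4 * (k : ℝ))) := by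
  obtain ⟨C, hC, h⟩ := exists_kolmogorov_bound_embeddingSum hk μ Q hf hC₀ hA
  refine ⟨C, hC, fun n hn x => ?_⟩
  specialize h n hn _ (hlaw n) x
  set τ : Ω n → (Fin n → S) × ({q : Fin n × Fin n // q.1 < q.2} → M) := fun ω =>
    ((fun i => X n i ω), (fun q : {q : Fin n × Fin n // q.1 < q.2} => Y n q.1.1 q.1.2 ω))
  have hτ : AEMeasurable τ (P n) := by
    by_contra hτ
    have h0 : (P n).map τ Set.univ = 1 :=
      (congrArg (fun ρ => ρ Set.univ) (hlaw n)).trans (by simp)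
    simp [Measure.map_of_not_aemeasurable hτ] at h0
  have hUm := measurable_embeddingSum (n := n) hf
  have hU : genU f (X n) (Y n) = embeddingSum n f ∘ τ := by
    ext ω
    exact genU_eq_sum_embedding f (X n) (Y n) (hYsym n) ω
  rw [Measure.map_apply_of_aemeasurable hτ
    (measurableSet_le ((hUm.sub_const _).div_const _) measurable_const),
    integral_map hτ hUm.aestronglyMeasurable, variance_map hUm.aemeasurable hτ, ← hU] at h
  convert h using 7
  ext ω
  simp only [genUbar, hU, Function.comp_apply, Set.mem_preimage, Set.mem_ofPred_eq]
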